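/- Let Ω ⊂ ℝ^n be a bounded domain with boundary of class C^{1+ε}, 0 < ε < 1, and let T be an even smooth homogeneous Calderón–Zygmund operator with kernel K. Then for every f ∈ Lip(ε,Ω) and every x ∈ ℝ^n outside the closure of Ω the integral Tf(x) = ∫_{Ω} f(y) K(x−y) dy converges absolutely, and the resulting function on ℝ^n ∖ closure(Ω) satisfies ‖Tf‖_{ε, ℝ^n∖closure(Ω)} ≤ C ‖T‖_CZ ‖f‖_{ε,Ω}, where C depends only on n, ε and Ω. -/

import Mathlib

open MeasureTheory Metric Set Filter Topology
open scoped ENNReal NNReal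

noncomputable section

/-- `ℝ^n` with the Euclidean norm. -/
abbrev En (n : ℕ) : Type := EuclideanSpace ℝ (Fin n)

/-- The Hölder norm `‖f‖_{ε,Ω} = sup_Ω |f| + σ_ε(f)`, valued in `ℝ≥0∞`. -/
def holderNorm {X : Type*} [NormedAddCommGroup X] (ε : ℝ) (Ω : Set X) (f : X → ℂ) : ℝ≥0∞ :=
  (⨆ x : Ω, (‖f x.1‖₊ : ℝ≥0∞)) +
    ⨆ p : Ω × Ω, ENNReal.ofReal (‖f p.1.1 - f p.2.1‖ / ‖p.1.1 - p.2.1‖ ^ ε)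

/-- The Calderón–Zygmund constant `‖T‖_CZ = sup_{x≠0}|K(x)||x|^n + sup_{x≠0}|∇K(x)||x|^{n+1}`. -/
def czConst (n : ℕ) (K : En n → ℝ) : ℝ≥0∞ :=
  (⨆ x : {x : En n // x ≠ 0}, ENNReal.ofReal (|K x.1| * ‖x.1‖ ^ n)) +
    ⨆ x : {x : En n // x ≠ 0}, ENNReal.ofReal (‖fderiv ℝ K x.1‖ * ‖x.1‖ ^ (n + 1))

/-- `Ω ⊆ ℝ^n` has boundary of class `C^{1+ε}`: near each boundary point, after a rotation,
`Ω` is the subgraph of a `C^1` function whose gradient is `ε`-Hölder. -/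
def HasC1HolderBoundary (n : ℕ) (ε : ℝ) (Ω : Set (En n)) : Prop :=
  ∃ hn : 0 < n, ∀ a ∈ frontier Ω, ∃ r > 0,
    ∃ R : En n ≃ₗᵢ[ℝ] En n, ∃ φ : (Fin (n - 1) → ℝ) → ℝ,
      ContDiff ℝ 1 φ ∧
      (∃ c : ℝ≥0, HolderOnWith c ε.toNNReal (fderiv ℝ φ) univ) ∧
      Ω ∩ ball a r = {x ∈ ball a r |
        R x ⟨n - 1, Nat.sub_lt hn Nat.one_pos⟩ <
          φ fun i : Fin (n - 1) => R x (Fin.castLE (Nat.sub_le n 1) i)}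



lemma exists_rot {n : ℕ} (u v : En n) (h : ‖u‖ = ‖v‖) : ∃ R : En n ≃ₗᵢ[ℝ] En n, R u = v :=
  ⟨_, Submodule.reflection_sub h⟩

lemma slab_vol {n : ℕ} (hn : 0 < n) (ℓ : En n →L[ℝ] ℝ) (hℓ : 1 ≤ ‖ℓ‖) (c : En n) (b ρ η : ℝ)
    (hρ : 0 ≤ ρ) (hη : 0 ≤ η) :
    volume {z | z ∈ ball c ρ ∧ |ℓ z - b| ≤ η} ≤ ENNReal.ofReal (2 ^ n * ρ ^ (n - 1) * η) := by
  set w : En n := (InnerProductSpace.toDual ℝ (En n)).symm ℓ with hw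
  have hwn : ‖w‖ = ‖ℓ‖ := by rw [hw]; exact LinearIsometryEquiv.norm_map _ _
  have hwin : ∀ z, inner ℝ w z = ℓ z := fun z => by
    rw [hw]; exact InnerProductSpace.toDual_symm_apply
  have hw1 : 1 ≤ ‖w‖ := hwn ▸ hℓ
  have hw0 : 0 < ‖w‖ := by linarith
  let i0 : Fin n := ⟨0, hn⟩
  obtain ⟨R, hR⟩ := exists_rot (‖w‖⁻¹ • w) (EuclideanSpace.single i0 (1 : ℝ)) (by
    rw [norm_smul, norm_inv, norm_norm, inv_mul_cancel₀ hw0.ne']; simp)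
  have hR0 : ∀ z, (R z) i0 = ‖w‖⁻¹ * ℓ z := by
    intro z
    have h1 : (R z) i0 = inner ℝ (EuclideanSpace.single i0 (1 : ℝ)) (R z) := by
      simp [EuclideanSpace.inner_single_left]
    rw [h1, ← hR, LinearIsometryEquiv.inner_map_map, real_inner_smul_left, hwin]
  have hmp := (EuclideanSpace.volume_preserving_symm_measurableEquiv_toLp (Fin n)).comp R.measurePreserving
  set lo : Fin n → ℝ := fun i => if i = i0 then ‖w‖⁻¹ * b - η else (R c) i - ρ with hlo
  set hi : Fin n → ℝ := fun i => if i = i0 then ‖w‖⁻¹ * b + η else (R c) i + ρ with hhi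
  have hsub : {z | z ∈ ball c ρ ∧ |ℓ z - b| ≤ η} ⊆
      ((MeasurableEquiv.toLp 2 (Fin n → ℝ)).symm ∘ R) ⁻¹' (Icc lo hi) := by
    rintro z ⟨hz, hz2⟩
    have key : ∀ i, lo i ≤ (R z) i ∧ (R z) i ≤ hi i := by
      intro i
      by_cases hi' : i = i0
      · subst hi'
        simp only [hlo, hhi, if_true, hR0]
        have : |‖w‖⁻¹ * ℓ z - ‖w‖⁻¹ * b| ≤ η := by
          rw [← mul_sub, abs_mul, abs_of_pos (inv_pos.2 hw0)]
          calc ‖w‖⁻¹ * |ℓ z - b| ≤ 1 * |ℓ z - b| := by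
                gcongr; exact inv_le_one_of_one_le₀ hw1
            _ ≤ η := by simpa using hz2
        rw [abs_le] at this
        constructor <;> linarith
      · simp only [hlo, hhi, if_neg hi']
        have h1 : |(R z) i - (R c) i| ≤ ρ := by
          have := EuclideanSpace.norm_eq (R z - R c)
          have h2 : ‖(R z - R c) i‖ ≤ ‖R z - R c‖ := PiLp.norm_apply_le _ i
          rw [← map_sub, LinearIsometryEquiv.norm_map, map_sub] at h2
          rw [mem_ball, dist_eq_norm] at hz
          have h3 : ‖(R z - R c) i‖ = |(R z) i - (R c) i| := by simp
          linarith
        rw [abs_le] at h1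
        constructor <;> linarith
    exact ⟨fun i => (key i).1, fun i => (key i).2⟩
  refine (measure_mono hsub).trans ?_
  rw [hmp.measure_preimage measurableSet_Icc.nullMeasurableSet, Real.volume_Icc_pi]
  rw [← Finset.mul_prod_erase _ _ (Finset.mem_univ i0)]
  have h1 : hi i0 - lo i0 = 2 * η := by simp [hlo, hhi]; ring
  have h2 : ∀ i ∈ Finset.univ.erase i0, ENNReal.ofReal (hi i - lo i) = ENNReal.ofReal (2 * ρ) := by
    intro i hi'
    have : i ≠ i0 := Finset.ne_of_mem_erase hi'
    simp only [hlo, hhi, if_neg this]; congr 1; ring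
  rw [h1, Finset.prod_congr rfl h2, Finset.prod_const, Finset.card_erase_of_mem (Finset.mem_univ _),
    Finset.card_univ, Fintype.card_fin, ← ENNReal.ofReal_pow (by positivity),
    ← ENNReal.ofReal_mul (by positivity)]
  apply le_of_eq
  congr 1
  obtain ⟨m, rfl⟩ : ∃ m, n = m + 1 := ⟨n - 1, by omega⟩
  simp; ring

open scoped Pointwise in
lemma cone_vol {n : ℕ} (hn : 0 < n) (ℓ : En n →L[ℝ] ℝ) (hℓ : 1 ≤ ‖ℓ‖) (t A B : ℝ)
    (ht : 0 ≤ t) (hA : 0 < A) (hAB : A ≤ B) :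
    volume.real {z | z ∈ ball (0 : En n) B ∧ z ∉ ball (0 : En n) A ∧ |ℓ z| ≤ t} ≤
      2 ^ n * (t / A) * (B ^ n - A ^ n) := by
  have : Nonempty (Fin n) := ⟨⟨0, hn⟩⟩
  set S : ℝ → Set (En n) := fun ρ => {z | z ∈ ball (0 : En n) ρ ∧ |ℓ z| ≤ t / A * ‖z‖} with hS
  have hSm : ∀ ρ, MeasurableSet (S ρ) := fun ρ => by
    apply measurableSet_ball.inter
    exact measurableSet_le (f := fun z => |ℓ z|) (g := fun z => t / A * ‖z‖) (by fun_prop) (by fun_prop)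
  have hfin : ∀ ρ, volume (S ρ) ≠ ⊤ := fun ρ =>
    ((measure_mono (fun z hz => hz.1)).trans_lt measure_ball_lt_top).ne
  have hsc : ∀ ρ, 0 < ρ → volume.real (S ρ) = ρ ^ n * volume.real (S 1) := by
    intro ρ hρ
    have : S ρ = ρ • S 1 := by
      ext z
      rw [mem_smul_set_iff_inv_smul_mem₀ hρ.ne']
      simp only [hS, mem_setOf_eq, mem_ball_zero_iff, norm_smul, norm_inv, Real.norm_of_nonneg hρ.le,
        map_smul, smul_eq_mul, abs_mul, abs_inv, abs_of_pos hρ]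
      have e1 : ρ⁻¹ * ‖z‖ < 1 ↔ ‖z‖ < ρ := by rw [inv_mul_lt_iff₀ hρ, mul_one]
      have e2 : ρ⁻¹ * |ℓ z| ≤ t / A * (ρ⁻¹ * ‖z‖) ↔ |ℓ z| ≤ t / A * ‖z‖ := by
        rw [mul_left_comm]
        exact mul_le_mul_iff_right₀ (inv_pos.2 hρ)
      rw [e1, e2]
    rw [this, measureReal_def, Measure.addHaar_smul, ENNReal.toReal_mul, measureReal_def]
    simp [abs_of_pos hρ, hρ.le]
  have h1 : volume.real (S 1) ≤ 2 ^ n * (t / A) := by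
    have := slab_vol hn ℓ hℓ 0 0 1 (t / A) zero_le_one (by positivity)
    have h2 : volume (S 1) ≤ ENNReal.ofReal (2 ^ n * 1 ^ (n - 1) * (t / A)) := by
      refine (measure_mono ?_).trans this
      rintro z ⟨hz, hz2⟩
      refine ⟨hz, ?_⟩
      rw [sub_zero]
      refine hz2.trans ?_
      rw [mem_ball_zero_iff] at hz
      exact mul_le_of_le_one_right (by positivity) hz.le
    have h3 := ENNReal.toReal_le_of_le_ofReal (by positivity) h2
    simpa [measureReal_def] using h3
  have hsub : {z | z ∈ ball (0 : En n) B ∧ z ∉ ball (0 : En n) A ∧ |ℓ z| ≤ t} ⊆ S B \ S A := by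
    rintro z ⟨hz, hz2, hz3⟩
    refine ⟨⟨hz, hz3.trans ?_⟩, fun h => hz2 h.1⟩
    rw [mem_ball_zero_iff, not_lt] at hz2
    rw [div_mul_eq_mul_div, le_div_iff₀ hA]
    gcongr
  have hSS : S A ⊆ S B := fun z hz => ⟨ball_subset_ball hAB hz.1, hz.2⟩
  calc _ ≤ volume.real (S B \ S A) := measureReal_mono hsub ((measure_mono sdiff_subset).trans_lt (hfin B).lt_top).ne
    _ = volume.real (S B) - volume.real (S A) := measureReal_sdiff hSS (hSm A) (hfin _)
    _ = (B ^ n - A ^ n) * volume.real (S 1) := by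
      rw [hsc B (by linarith), hsc A hA]; ring
    _ ≤ (B ^ n - A ^ n) * (2 ^ n * (t / A)) := by
      gcongr
      rw [sub_nonneg]; gcongr
    _ = _ := by ring

lemma pow_sub_pow_bd (n : ℕ) (A B : ℝ) (hA : 0 ≤ A) (hAB : A ≤ B) :
    B ^ n - A ^ n ≤ n * B ^ (n - 1) * (B - A) := by
  induction n with
  | zero => simp
  | succ k ih =>
    have hB : 0 ≤ B := hA.trans hAB
    have h1 : A ^ k ≤ B ^ k := by gcongr
    rcases Nat.eq_zero_or_pos k with rfl | hk
    · simp
    obtain ⟨j, rfl⟩ : ∃ j, k = j + 1 := ⟨k - 1, by omega⟩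
    simp only [Nat.add_sub_cancel] at ih ⊢
    have e : B ^ (j + 1 + 1) - A ^ (j + 1 + 1) = B * (B ^ (j+1) - A ^ (j+1)) + A ^ (j+1) * (B - A) := by ring
    rw [e]
    have h2 : B * (B ^ (j+1) - A ^ (j+1)) ≤ B * (((j + 1 : ℕ) : ℝ) * B ^ j * (B - A)) := by gcongr
    have h3 : A ^ (j+1) * (B - A) ≤ B ^ (j+1) * (B - A) := by
      apply mul_le_mul_of_nonneg_right h1; linarith
    push_cast at h2 ⊢
    have e2 : ((j : ℝ) + 1 + 1) * B ^ (j + 1) * (B - A) = B * (((j : ℝ) + 1) * B ^ j * (B - A)) + B ^ (j+1) * (B - A) := by ring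
    linarith

/-- unit ball volume -/
def ub (n : ℕ) : ℝ := volume.real (ball (0 : En n) 1)

lemma ub_nonneg (n : ℕ) : 0 ≤ ub n := measureReal_nonneg

lemma shell_vol {n : ℕ} (hn : 0 < n) (x : En n) (A B : ℝ) (hA : 0 ≤ A) (hAB : A ≤ B) :
    volume.real (ball x B \ ball x A) ≤ n * B ^ (n - 1) * (B - A) * ub n := by
  have : Nonempty (Fin n) := ⟨⟨0, hn⟩⟩
  have h : ∀ r, 0 ≤ r → volume.real (ball x r) = r ^ n * ub n := by
    intro r hr
    rw [measureReal_def, Measure.addHaar_ball _ _ hr, ENNReal.toReal_mul, ub, measureReal_def]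
    simp [hr]
  rw [measureReal_sdiff (ball_subset_ball hAB) measurableSet_ball measure_ball_lt_top.ne,
    h B (hA.trans hAB), h A hA, ← sub_mul]
  exact mul_le_mul_of_nonneg_right (pow_sub_pow_bd n A B hA hAB) (ub_nonneg n)

/-- dyadic decomposition constant -/
def dyC (a b : ℝ) : ℝ := 2 ^ a / (1 - 2 ^ (a - b))

lemma dyC_pos (a b : ℝ) (hab : a < b) : 0 < dyC a b := by
  have : (2 : ℝ) ^ (a - b) < 1 := Real.rpow_lt_one_of_one_lt_of_neg (by norm_num) (by linarith)
  unfold dyC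
  apply div_pos (by positivity); linarith

lemma dyadic_lint {n : ℕ} (μ : Measure (En n)) (x : En n) (a b t M : ℝ) (hab : a < b) (hb : 0 ≤ b)
    (ht : 0 < t) (hM : 0 ≤ M)
    (h : ∀ ρ, t ≤ ρ → μ (ball x ρ) ≤ ENNReal.ofReal (M * ρ ^ a)) :
    ∫⁻ y in (ball x t)ᶜ, ENNReal.ofReal (‖x - y‖ ^ (-b)) ∂μ ≤
      ENNReal.ofReal (dyC a b * M * t ^ (a - b)) := by
  set s : ℕ → Set (En n) := fun k => ball x (2 ^ (k + 1) * t) \ ball x (2 ^ k * t) with hs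
  have hcov : (ball x t)ᶜ ⊆ ⋃ k, s k := by
    intro y hy
    rw [mem_compl_iff, mem_ball, not_lt] at hy
    have hy1 : 1 ≤ dist y x / t := by rwa [le_div_iff₀ ht, one_mul]
    obtain ⟨k, hk1, hk2⟩ := exists_nat_pow_near hy1 (one_lt_two)
    rw [le_div_iff₀ ht] at hk1
    rw [div_lt_iff₀ ht] at hk2
    exact mem_iUnion.2 ⟨k, hk2, by rw [mem_ball, not_lt]; exact hk1⟩
  have hq : (2 : ℝ) ^ (a - b) < 1 := Real.rpow_lt_one_of_one_lt_of_neg (by norm_num) (by linarith)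
  have hq0 : 0 ≤ (2 : ℝ) ^ (a - b) := by positivity
  have hk : ∀ k, ∫⁻ y in s k, ENNReal.ofReal (‖x - y‖ ^ (-b)) ∂μ ≤
      ENNReal.ofReal (2 ^ a * M * t ^ (a - b) * ((2 : ℝ) ^ (a - b)) ^ k) := by
    intro k
    have hmeas : MeasurableSet (s k) := measurableSet_ball.diff measurableSet_ball
    calc ∫⁻ y in s k, ENNReal.ofReal (‖x - y‖ ^ (-b)) ∂μ
        ≤ ∫⁻ y in s k, ENNReal.ofReal ((2 ^ k * t) ^ (-b)) ∂μ := by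
          apply setLIntegral_mono' hmeas
          rintro y ⟨_, hy⟩
          rw [mem_ball, not_lt, dist_comm, dist_eq_norm] at hy
          apply ENNReal.ofReal_le_ofReal
          exact Real.rpow_le_rpow_of_nonpos (by positivity) hy (by linarith)
      _ = ENNReal.ofReal ((2 ^ k * t) ^ (-b)) * μ (s k) := by simp
      _ ≤ ENNReal.ofReal ((2 ^ k * t) ^ (-b)) * ENNReal.ofReal (M * (2 ^ (k + 1) * t) ^ a) := by
          gcongr
          refine (measure_mono sdiff_subset).trans (h _ ?_)
          have : (1 : ℝ) ≤ 2 ^ (k + 1) := one_le_pow₀ (by norm_num)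
          nlinarith
      _ = _ := by
          rw [← ENNReal.ofReal_mul (by positivity)]
          congr 1
          have e1 : ((2 : ℝ) ^ k * t) ^ (-b) = (2 ^ (-b)) ^ k * t ^ (-b) := by
            rw [Real.mul_rpow (by positivity) ht.le, ← Real.rpow_natCast, ← Real.rpow_natCast,
              ← Real.rpow_mul (by norm_num), ← Real.rpow_mul (by norm_num), mul_comm (k : ℝ)]
          have e2 : ((2 : ℝ) ^ (k + 1) * t) ^ a = 2 ^ a * (2 ^ a) ^ k * t ^ a := by
            rw [Real.mul_rpow (by positivity) ht.le, ← pow_succ', ← Real.rpow_natCast, ← Real.rpow_natCast,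
              ← Real.rpow_mul (by norm_num), ← Real.rpow_mul (by norm_num), mul_comm (((k+1 : ℕ)) : ℝ)]
          have e3 : (2 : ℝ) ^ (a - b) = 2 ^ a * 2 ^ (-b) := by
            rw [← Real.rpow_add (by norm_num)]; rfl
          have e4 : t ^ (a - b) = t ^ a * t ^ (-b) := by
            rw [← Real.rpow_add ht]; rfl
          rw [e1, e2, e3, e4, mul_pow]; ring
  calc _ ≤ ∫⁻ y in ⋃ k, s k, ENNReal.ofReal (‖x - y‖ ^ (-b)) ∂μ := lintegral_mono_set hcov
    _ ≤ ∑' k, ∫⁻ y in s k, ENNReal.ofReal (‖x - y‖ ^ (-b)) ∂μ := lintegral_iUnion_le _ _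
    _ ≤ ∑' k, ENNReal.ofReal (2 ^ a * M * t ^ (a - b) * ((2 : ℝ) ^ (a - b)) ^ k) :=
      ENNReal.tsum_le_tsum hk
    _ = ENNReal.ofReal (∑' k, 2 ^ a * M * t ^ (a - b) * ((2 : ℝ) ^ (a - b)) ^ k) := by
      rw [ENNReal.ofReal_tsum_of_nonneg]
      · intro k; positivity
      · exact (summable_geometric_of_lt_one hq0 hq).mul_left _
    _ = _ := by
      rw [tsum_mul_left, tsum_geometric_of_lt_one hq0 hq, dyC]
      congr 1; ring

lemma dyadic_int {n : ℕ} {F : Type*} [NormedAddCommGroup F] [NormedSpace ℝ F]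
    (S : Set (En n)) (hS : MeasurableSet S) (x : En n) (a b t M A : ℝ) (hab : a < b) (hb : 0 ≤ b)
    (ht : 0 < t) (hM : 0 ≤ M) (hA : 0 ≤ A)
    (h : ∀ ρ, t ≤ ρ → volume (S ∩ ball x ρ) ≤ ENNReal.ofReal (M * ρ ^ a))
    (hSt : ∀ y ∈ S, t ≤ ‖x - y‖) (g : En n → F) (hg : ∀ y ∈ S, ‖g y‖ ≤ A * ‖x - y‖ ^ (-b)) :
    ‖∫ y in S, g y‖ ≤ A * (dyC a b * M * t ^ (a - b)) := by
  have h1 := dyadic_lint (volume.restrict S) x a b t M hab hb ht hM (fun ρ hρ => by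
    rw [Measure.restrict_apply measurableSet_ball, inter_comm]; exact h ρ hρ)
  have hd := dyC_pos a b hab
  refine (norm_integral_le_lintegral_norm _).trans ?_
  apply ENNReal.toReal_le_of_le_ofReal (by positivity)
  have h2 : (volume.restrict S).restrict (ball x t)ᶜ = volume.restrict S := by
    rw [Measure.restrict_restrict measurableSet_ball.compl]
    congr 1
    rw [inter_eq_right]
    intro y hy
    rw [mem_compl_iff, mem_ball, not_lt, dist_comm, dist_eq_norm]; exact hSt y hy
  rw [h2] at h1
  calc ∫⁻ y in S, ENNReal.ofReal ‖g y‖ ≤ ∫⁻ y in S, ENNReal.ofReal A * ENNReal.ofReal (‖x - y‖ ^ (-b)) := by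
        apply setLIntegral_mono' hS
        intro y hy
        rw [← ENNReal.ofReal_mul hA]
        exact ENNReal.ofReal_le_ofReal (hg y hy)
    _ = ENNReal.ofReal A * ∫⁻ y in S, ENNReal.ofReal (‖x - y‖ ^ (-b)) := by
        rw [lintegral_const_mul' _ _ ENNReal.ofReal_ne_top]
    _ ≤ _ := by
        rw [ENNReal.ofReal_mul hA]; gcongr


/-- Quantitative data of an even smooth homogeneous kernel. -/
structure CZK (n : ℕ) (K : En n → ℝ) (B : ℝ) : Prop where
  nonneg : 0 ≤ B
  smooth : ContDiffOn ℝ 1 K {(0 : En n)}ᶜ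
  size : ∀ z, z ≠ 0 → |K z| ≤ B / ‖z‖ ^ n
  grad : ∀ z, z ≠ 0 → ‖fderiv ℝ K z‖ ≤ B / ‖z‖ ^ (n + 1)
  homog : ∀ t : ℝ, 0 < t → ∀ z, z ≠ 0 → K (t • z) = (t ^ n)⁻¹ * K z
  even : ∀ z, K (-z) = K z
  mean : ∀ a b : ℝ, 0 < a → a ≤ b → ∫ z in ball (0 : En n) b \ ball 0 a, K z = 0

lemma norm_pos_ne {n : ℕ} {z : En n} {a : ℝ} (ha : 0 < a) (h : a ≤ ‖z‖) : z ≠ 0 := by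
  intro h0; rw [h0, norm_zero] at h; linarith

lemma CZK.bd {n : ℕ} {K : En n → ℝ} {B : ℝ} (hK : CZK n K B) {z : En n} {a : ℝ} (ha : 0 < a)
    (h : a ≤ ‖z‖) : |K z| ≤ B / a ^ n := by
  refine (hK.size z (norm_pos_ne ha h)).trans ?_
  have := hK.nonneg
  gcongr

lemma CZK.intOn {n : ℕ} {K : En n → ℝ} {B : ℝ} (hK : CZK n K B) (x : En n) (S : Set (En n))
    (hS : MeasurableSet S) (hfin : volume S ≠ ⊤) {a : ℝ} (ha : 0 < a) (h : ∀ y ∈ S, a ≤ ‖x - y‖) :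
    IntegrableOn (fun y => K (x - y)) S := by
  refine IntegrableOn.of_bound hfin.lt_top ?_ (B / a ^ n) ?_
  · apply ContinuousOn.aestronglyMeasurable _ hS
    apply hK.smooth.continuousOn.comp (by fun_prop)
    intro y hy
    exact norm_pos_ne ha (h y hy)
  · filter_upwards [ae_restrict_mem hS] with y hy
    exact hK.bd ha (h y hy)

lemma CZK.intOn0 {n : ℕ} {K : En n → ℝ} {B : ℝ} (hK : CZK n K B) (S : Set (En n))
    (hS : MeasurableSet S) (hfin : volume S ≠ ⊤) {a : ℝ} (ha : 0 < a) (h : ∀ y ∈ S, a ≤ ‖y‖) :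
    IntegrableOn K S := by
  have := hK.intOn 0 S hS hfin ha (by simpa using h)
  simpa [hK.even] using this

lemma CZK.diff {n : ℕ} {K : En n → ℝ} {B : ℝ} (hK : CZK n K B) (x x' y : En n) (hxy : x ≠ y)
    (h : 2 * ‖x - x'‖ ≤ ‖x - y‖) :
    |K (x - y) - K (x' - y)| ≤ B * 2 ^ (n + 1) * ‖x - x'‖ / ‖x - y‖ ^ (n + 1) := by
  have h0 : 0 < ‖x - y‖ := norm_pos_iff.2 (sub_ne_zero.2 hxy)
  have hlow : ∀ z ∈ closedBall (x - y) ‖x - x'‖, ‖x - y‖ / 2 ≤ ‖z‖ := by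
    intro z hz
    rw [mem_closedBall, dist_comm, dist_eq_norm] at hz
    have := norm_sub_norm_le (x - y) z
    linarith
  have h1 := Convex.norm_image_sub_le_of_norm_fderiv_le (𝕜 := ℝ) (f := K)
    (C := B / (‖x - y‖ / 2) ^ (n + 1)) (s := closedBall (x - y) ‖x - x'‖) (x := x' - y) (y := x - y)
    (fun z hz => by
      have hz0 := norm_pos_ne (by linarith) (hlow z hz)
      exact (hK.smooth.contDiffAt (isOpen_compl_singleton.mem_nhds hz0)).differentiableAt (by simp))
    (fun z hz => by
      have hz0 := norm_pos_ne (by linarith) (hlow z hz)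
      refine (hK.grad z hz0).trans ?_
      have := hK.nonneg
      have := hlow z hz
      gcongr)
    (convex_closedBall _ _)
    (by rw [mem_closedBall, dist_eq_norm, ← norm_neg]; apply le_of_eq; congr 1; abel)
    (mem_closedBall_self (norm_nonneg _))
  rw [Real.norm_eq_abs] at h1
  refine h1.trans (le_of_eq ?_)
  have : x - y - (x' - y) = x - x' := by abel
  rw [this, div_pow]
  field_simp

lemma null_hyper {n : ℕ} (hn : 0 < n) (ℓ : En n →L[ℝ] ℝ) (hℓ : 1 ≤ ‖ℓ‖) (R : ℝ) (hR : 0 ≤ R) :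
    volume {z | z ∈ ball (0 : En n) R ∧ ℓ z = 0} = 0 := by
  have := slab_vol hn ℓ hℓ 0 0 R 0 hR le_rfl
  simpa using this

lemma CZK.half {n : ℕ} (hn : 0 < n) {K : En n → ℝ} {B : ℝ} (hK : CZK n K B) (ℓ : En n →L[ℝ] ℝ)
    (hℓ : 1 ≤ ‖ℓ‖) (a b : ℝ) (ha : 0 < a) (hab : a ≤ b) :
    ∫ z in (ball (0 : En n) b \ ball 0 a) ∩ {z | 0 < ℓ z}, K z = 0 := by
  set A := ball (0 : En n) b \ ball 0 a with hA
  have hAm : MeasurableSet A := measurableSet_ball.diff measurableSet_ball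
  have hAf : volume A ≠ ⊤ := ((measure_mono sdiff_subset).trans_lt measure_ball_lt_top).ne
  have hAi : IntegrableOn K A := hK.intOn0 A hAm hAf ha (fun y hy => by
    have := hy.2
    rwa [mem_ball_zero_iff, not_lt] at this)
  have hP : MeasurableSet {z : En n | 0 < ℓ z} := measurableSet_lt measurable_const ℓ.measurable
  have hN : MeasurableSet {z : En n | ℓ z < 0} := measurableSet_lt ℓ.measurable measurable_const
  have h1 := integral_inter_add_sdiff hP hAi
  rw [hK.mean a b ha hab] at h1
  have h2 : ∫ z in A \ {z | 0 < ℓ z}, K z = ∫ z in A ∩ {z | ℓ z < 0}, K z := by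
    apply setIntegral_congr_set
    rw [ae_eq_set]
    constructor
    · refine measure_mono_null ?_ (null_hyper hn ℓ hℓ b (by linarith))
      rintro z ⟨⟨hz1, hz2⟩, hz3⟩
      refine ⟨hz1.1, le_antisymm (not_lt.1 hz2) (not_lt.1 fun h => hz3 ⟨hz1, h⟩)⟩
    · convert measure_empty (μ := (volume : Measure (En n)))
      rw [sdiff_eq_empty]
      rintro z ⟨hz1, hz2⟩
      exact ⟨hz1, fun h => lt_asymm (show ℓ z < 0 from hz2) h⟩
  have h3 : ∫ z in A ∩ {z | ℓ z < 0}, K z = ∫ z in A ∩ {z | 0 < ℓ z}, K z := by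
    have hmp : MeasurePreserving (fun z : En n => -z) volume volume := Measure.measurePreserving_neg _
    have := hmp.setIntegral_preimage_emb (MeasurableEquiv.neg (En n)).measurableEmbedding K
      (A ∩ {z | ℓ z < 0})
    rw [← this]
    simp only [hK.even]
    congr 2
    ext z
    simp [hA]
  rw [h2, h3] at h1
  linarith

/-- truncated half-space integral -/
def JJ {n : ℕ} (K : En n → ℝ) (ℓ : En n →L[ℝ] ℝ) (R t : ℝ) : ℝ :=
  ∫ z in ball (0 : En n) R ∩ {z | t < ℓ z}, K z

open scoped Pointwise in
lemma CZK.JJ_scale {n : ℕ} {K : En n → ℝ} {B : ℝ} (hK : CZK n K B) (ℓ : En n →L[ℝ] ℝ) (R t l : ℝ)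
    (ht : 0 < t) (hl : 0 < l) : JJ K ℓ (l * R) (l * t) = JJ K ℓ R t := by
  have hm : MeasurableSet (ball (0 : En n) R ∩ {z | t < ℓ z}) :=
    measurableSet_ball.inter (measurableSet_lt measurable_const ℓ.measurable)
  have h1 := Measure.setIntegral_comp_smul_of_pos (volume : Measure (En n)) K
    (ball (0 : En n) R ∩ {z | t < ℓ z}) hl
  have h2 : l • (ball (0 : En n) R ∩ {z | t < ℓ z}) = ball (0 : En n) (l * R) ∩ {z | l * t < ℓ z} := by
    ext z
    rw [mem_smul_set_iff_inv_smul_mem₀ hl.ne']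
    simp only [mem_inter_iff, mem_ball_zero_iff, norm_smul, norm_inv, Real.norm_of_nonneg hl.le,
      mem_ofPred_eq, map_smul, smul_eq_mul]
    rw [inv_mul_lt_iff₀ hl, lt_inv_mul_iff₀ hl]
  rw [h2] at h1
  have h3 : ∫ z in ball (0 : En n) R ∩ {z | t < ℓ z}, K (l • z) =
      (l ^ n)⁻¹ * ∫ z in ball (0 : En n) R ∩ {z | t < ℓ z}, K z := by
    rw [← integral_const_mul]
    apply setIntegral_congr_fun hm
    rintro z ⟨_, hz⟩
    refine hK.homog l hl z ?_
    rintro rfl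
    simp at hz; linarith
  rw [h3] at h1
  simp only [finrank_euclideanSpace, Fintype.card_fin, smul_eq_mul] at h1
  unfold JJ
  have : (l ^ n)⁻¹ ≠ 0 := by positivity
  exact (mul_left_cancel₀ this h1).symm

lemma CZK.JJ_diff {n : ℕ} (hn : 0 < n) {K : En n → ℝ} {B : ℝ} (hK : CZK n K B) (ℓ : En n →L[ℝ] ℝ)
    (hℓ : 1 ≤ ‖ℓ‖) (R R' t : ℝ) (ht : 0 < t) (hR : 0 < R) (hRR : R ≤ R') :
    |JJ K ℓ R' t - JJ K ℓ R t| ≤ B / R ^ n * (2 ^ n * (t / R) * (R' ^ n - R ^ n)) := by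
  set P := fun s : ℝ => {z : En n | s < ℓ z} with hPdef
  have hP : ∀ s, MeasurableSet (P s) := fun s => measurableSet_lt measurable_const ℓ.measurable
  set A := ball (0 : En n) R' \ ball 0 R with hA
  have hAm : MeasurableSet A := measurableSet_ball.diff measurableSet_ball
  have hAf : volume A ≠ ⊤ := ((measure_mono sdiff_subset).trans_lt measure_ball_lt_top).ne
  have hAi : IntegrableOn K A := hK.intOn0 A hAm hAf hR (fun y hy => by
    have := hy.2
    rwa [mem_ball_zero_iff, not_lt] at this)
  have hℓ0 : 0 < ‖ℓ‖ := by linarith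
  have hi : IntegrableOn K (ball (0 : En n) R' ∩ P t) := by
    refine hK.intOn0 _ (measurableSet_ball.inter (hP t))
      ((measure_mono inter_subset_left).trans_lt measure_ball_lt_top).ne (a := t / ‖ℓ‖) (by positivity) ?_
    rintro y ⟨_, hy⟩
    rw [div_le_iff₀ hℓ0]
    have h1 := ℓ.le_opNorm y
    have h2 := le_abs_self (ℓ y)
    rw [Real.norm_eq_abs] at h1
    have h3 : t < ℓ y := hy
    linarith
  have e1 : JJ K ℓ R' t - JJ K ℓ R t = ∫ z in A ∩ P t, K z := by
    have := integral_inter_add_sdiff (measurableSet_ball (x := (0 : En n)) (ε := R)) hi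
    have s1 : ball (0 : En n) R' ∩ P t ∩ ball 0 R = ball 0 R ∩ P t := by
      ext z; constructor
      · rintro ⟨⟨_, h⟩, h'⟩; exact ⟨h', h⟩
      · rintro ⟨h', h⟩; exact ⟨⟨ball_subset_ball hRR h', h⟩, h'⟩
    have s2 : (ball (0 : En n) R' ∩ P t) \ ball 0 R = A ∩ P t := by
      ext z; constructor
      · rintro ⟨⟨h1, h⟩, h'⟩; exact ⟨⟨h1, h'⟩, h⟩
      · rintro ⟨⟨h1, h'⟩, h⟩; exact ⟨⟨h1, h⟩, h'⟩
    rw [s1, s2] at this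
    unfold JJ
    simp only [hPdef] at this ⊢
    linarith
  have e2 : ∫ z in A ∩ P t, K z = - ∫ z in (A ∩ P 0) \ P t, K z := by
    have := integral_inter_add_sdiff (hP t) (hAi.mono_set (inter_subset_left (t := P 0)))
    have s1 : A ∩ P 0 ∩ P t = A ∩ P t := by
      ext z; constructor
      · rintro ⟨⟨h, _⟩, h'⟩; exact ⟨h, h'⟩
      · rintro ⟨h, h'⟩; exact ⟨⟨h, lt_trans ht h'⟩, h'⟩
    rw [s1, hK.half hn ℓ hℓ R R' hR hRR] at this
    linarith
  rw [e1, e2, abs_neg]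
  have hsub : (A ∩ P 0) \ P t ⊆ {z | z ∈ ball (0 : En n) R' ∧ z ∉ ball (0 : En n) R ∧ |ℓ z| ≤ t} := by
    rintro z ⟨⟨h1, h2⟩, h3⟩
    have h2' : 0 < ℓ z := h2
    refine ⟨h1.1, h1.2, ?_⟩
    rw [abs_of_pos h2']
    exact not_lt.1 h3
  have hf1 : volume ((A ∩ P 0) \ P t) < ⊤ :=
    (measure_mono (sdiff_subset.trans inter_subset_left)).trans_lt hAf.lt_top
  have h5 := norm_setIntegral_le_of_norm_le_const (f := K) (C := B / R ^ n) hf1 (fun z hz => by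
    apply hK.bd hR
    have := hz.1.1.2
    rwa [mem_ball_zero_iff, not_lt] at this)
  refine h5.trans ?_
  have hB := hK.nonneg
  gcongr
  refine (measureReal_mono hsub ?_).trans (cone_vol hn ℓ hℓ t R R' ht.le hR hRR)
  exact ((measure_mono (fun z hz => hz.1)).trans_lt (measure_ball_lt_top (x := (0 : En n)) (r := R'))).ne

/-- constant in the half-space Lipschitz bound -/
def JC (n : ℕ) (R : ℝ) : ℝ := ((R / 2) ^ n)⁻¹ * 2 ^ n * 4 * n * (2 * R) ^ (n - 1)

lemma CZK.JJ_lip {n : ℕ} (hn : 0 < n) {K : En n → ℝ} {B : ℝ} (hK : CZK n K B) (ℓ : En n →L[ℝ] ℝ)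
    (hℓ : 1 ≤ ‖ℓ‖) (R t t' : ℝ) (ht : 0 < t) (hR : 0 < R) (htt : |t - t'| ≤ t / 2) :
    |JJ K ℓ R t - JJ K ℓ R t'| ≤ B * JC n R * |t - t'| := by
  have hB := hK.nonneg
  rw [abs_le] at htt
  have ht' : 0 < t' := by linarith [htt.2]
  set R' := t / t' * R with hR'
  have e : JJ K ℓ R t' = JJ K ℓ R' t := by
    rw [← hK.JJ_scale ℓ R t' (t / t') ht' (by positivity)]
    congr 1; field_simp
  have hq1 : t / t' ≤ 2 := by rw [div_le_iff₀ ht']; linarith [htt.2]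
  have hq2 : 1 / 2 ≤ t / t' := by rw [le_div_iff₀ ht']; linarith [htt.1]
  have hR1 : R' ≤ 2 * R := by rw [hR']; gcongr
  have hR2 : R / 2 ≤ R' := by rw [hR']; nlinarith
  have hRd : |R' - R| = R / t' * |t - t'| := by
    rw [← abs_of_pos (show 0 < R / t' by positivity), ← abs_mul]; congr 1
    rw [hR']; field_simp
  have main : ∀ r r', R / 2 ≤ r → r ≤ r' → r' ≤ 2 * R → r' - r = |R' - R| →
      |JJ K ℓ r' t - JJ K ℓ r t| ≤ B * JC n R * |t - t'| := by
    intro r r' h1 h2 h3 h4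
    have hr : 0 < r := by linarith
    refine (hK.JJ_diff hn ℓ hℓ r r' t ht hr h2).trans ?_
    have h5 := pow_sub_pow_bd n r r' hr.le h2
    have h6 : t / r * (r' - r) ≤ 4 * |t - t'| := by
      rw [h4, hRd]
      have : t / r * (R / t' * |t - t'|) = (t / t') * (R / r) * |t - t'| := by field_simp
      rw [this]
      have h7 : R / r ≤ 2 := by rw [div_le_iff₀ hr]; linarith
      calc (t / t') * (R / r) * |t - t'| ≤ 2 * 2 * |t - t'| := by gcongr
        _ = _ := by ring
    calc B / r ^ n * (2 ^ n * (t / r) * (r' ^ n - r ^ n))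
        ≤ B / r ^ n * (2 ^ n * (t / r) * (n * r' ^ (n - 1) * (r' - r))) := by gcongr
      _ = B * (r ^ n)⁻¹ * 2 ^ n * n * r' ^ (n - 1) * (t / r * (r' - r)) := by ring
      _ ≤ B * ((R / 2) ^ n)⁻¹ * 2 ^ n * n * (2 * R) ^ (n - 1) * (4 * |t - t'|) := by
        have h8 : 0 ≤ r' := by linarith
        have h9 : 0 ≤ t / r * (r' - r) := mul_nonneg (by positivity) (by linarith)
        gcongr
      _ = _ := by rw [JC]; ring
  rw [e]
  rcases le_total R R' with h | h
  · rw [abs_sub_comm]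
    exact main R R' (by linarith) h hR1 (by rw [abs_of_nonneg]; linarith)
  · exact main R' R hR2 h (by linarith) (by rw [abs_of_nonpos] <;> linarith)


/-- Local defining function of the domain near a boundary point. -/
structure Chart (n : ℕ) (Ω : Set (En n)) (ε : ℝ) (a : En n) (r L M : ℝ) (Φ : En n → ℝ) (e : En n) :
    Prop where
  rpos : 0 < r
  hL : 1 ≤ L
  hM : 0 ≤ M
  enorm : ‖e‖ = 1
  diff : Differentiable ℝ Φ
  hold : ∀ y z, ‖fderiv ℝ Φ y - fderiv ℝ Φ z‖ ≤ M * ‖y - z‖ ^ ε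
  up : ∀ y, ∀ s : ℝ, Φ (y + s • e) = Φ y + s
  lip : ∀ y ∈ ball a r, ‖fderiv ℝ Φ y‖ ≤ L
  mem : ∀ y ∈ ball a r, (y ∈ Ω ↔ Φ y < 0)
  zero : Φ a = 0

namespace Chart
variable {n : ℕ} {Ω : Set (En n)} {ε : ℝ} {a : En n} {r L M : ℝ} {Φ : En n → ℝ} {e : En n}

lemma fd_e (h : Chart n Ω ε a r L M Φ e) (y : En n) : fderiv ℝ Φ y e = 1 := by
  have h1 : HasDerivAt (fun s : ℝ => Φ (y + s • e)) (fderiv ℝ Φ y e) 0 := by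
    have := (h.diff y).hasFDerivAt.hasLineDerivAt e
    exact this
  have h2 : HasDerivAt (fun s : ℝ => Φ (y + s • e)) 1 0 := by
    simp only [h.up]
    exact (hasDerivAt_id _).const_add _
  exact h1.unique h2

lemma fd_norm (h : Chart n Ω ε a r L M Φ e) (y : En n) : 1 ≤ ‖fderiv ℝ Φ y‖ := by
  have := (fderiv ℝ Φ y).le_opNorm e
  rw [h.fd_e, h.enorm] at this
  simpa using this

lemma taylor (h : Chart n Ω ε a r L M Φ e) (hε : 0 < ε) (y z : En n) :
    |Φ y - Φ z - fderiv ℝ Φ z (y - z)| ≤ M * ‖y - z‖ ^ (1 + ε) := by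
  have hM := h.hM
  have := Convex.norm_image_sub_le_of_norm_fderiv_le' (𝕜 := ℝ) (f := Φ) (φ := fderiv ℝ Φ z)
    (C := M * ‖y - z‖ ^ ε) (s := closedBall z ‖y - z‖) (x := z) (y := y)
    (fun w _ => h.diff w) (fun w hw => by
      refine (h.hold w z).trans ?_
      rw [mem_closedBall, dist_eq_norm] at hw
      gcongr) (convex_closedBall _ _) (mem_closedBall_self (norm_nonneg _))
      (by rw [mem_closedBall, dist_eq_norm])
  rw [Real.norm_eq_abs] at this
  refine this.trans (le_of_eq ?_)
  rcases eq_or_ne y z with rfl | hyz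
  · simp [Real.zero_rpow (show 1 + ε ≠ 0 by positivity)]
  · rw [add_comm, Real.rpow_add_one (norm_ne_zero_iff.2 (sub_ne_zero.2 hyz))]; ring

lemma lip' (h : Chart n Ω ε a r L M Φ e) {y z : En n} (hy : y ∈ ball a r) (hz : z ∈ ball a r) :
    |Φ y - Φ z| ≤ L * ‖y - z‖ :=
  Convex.norm_image_sub_le_of_norm_fderiv_le (𝕜 := ℝ) (f := Φ) (fun w _ => h.diff w)
    h.lip (convex_ball a r) hz hy

lemma small (h : Chart n Ω ε a r L M Φ e) {x : En n} (hx : x ∈ ball a (r / (4 * L))) :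
    x ∈ ball a (r / 4) ∧ |Φ x| ≤ r / 4 := by
  have hL := h.hL
  have hr := h.rpos
  have h1 : r / (4 * L) ≤ r / 4 := by gcongr; linarith
  have hx1 : x ∈ ball a (r / 4) := ball_subset_ball h1 hx
  refine ⟨hx1, ?_⟩
  have := h.lip' (ball_subset_ball (by linarith) hx1) (mem_ball_self hr)
  rw [h.zero, sub_zero] at this
  rw [mem_ball, dist_eq_norm] at hx
  calc |Φ x| ≤ L * ‖x - a‖ := this
    _ ≤ L * (r / (4 * L)) := by gcongr
    _ = r / 4 := by field_simp

/-- points of the domain are far from a point with positive height -/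
lemma far (h : Chart n Ω ε a r L M Φ e) {x : En n} (hx : x ∈ ball a (r / (4 * L))) {y : En n}
    (hy : y ∈ Ω) : Φ x ≤ L * ‖x - y‖ := by
  have hL := h.hL
  have hr := h.rpos
  obtain ⟨h1, h2⟩ := h.small hx
  have hxr := ball_subset_ball (show r / 4 ≤ r by linarith) h1
  by_cases hyr : y ∈ ball a r
  · have h3 := h.lip' hxr hyr
    have h4 := (h.mem y hyr).1 hy
    have := le_abs_self (Φ x - Φ y)
    linarith
  · rw [mem_ball, not_lt, dist_eq_norm] at hyr
    rw [mem_ball, dist_eq_norm] at h1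
    have h3 : ‖y - a‖ ≤ ‖x - y‖ + ‖x - a‖ := by
      have := norm_sub_le (x - a) (x - y)
      have e : x - a - (x - y) = y - a := by abel
      rw [e] at this; linarith
    have h5 := le_abs_self (Φ x)
    have h6 : ‖x - y‖ ≤ L * ‖x - y‖ := le_mul_of_one_le_left (norm_nonneg _) hL
    linarith

end Chart

lemma JJ_trans {n : ℕ} (K : En n → ℝ) (ℓ : En n →L[ℝ] ℝ) (x : En n) (R c : ℝ) :
    ∫ y in ball x R ∩ {y | ℓ y < c}, K (x - y) = JJ K ℓ R (ℓ x - c) := by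
  have hmp : MeasurePreserving (fun z : En n => x - z) volume volume :=
    Measure.measurePreserving_sub_left volume x
  have := hmp.setIntegral_preimage_emb (MeasurableEquiv.subLeft x).measurableEmbedding K
    (ball 0 R ∩ {z | ℓ x - c < ℓ z})
  rw [JJ, ← this]
  congr 2
  ext y
  simp only [mem_inter_iff, mem_preimage, mem_ofPred_eq, map_sub, mem_ball, dist_comm y x,
    dist_eq_norm, sub_zero]
  constructor <;> rintro ⟨h1, h2⟩ <;> exact ⟨h1, by linarith⟩

lemma CZK.shell {n : ℕ} (hn : 0 < n) {K : En n → ℝ} {B : ℝ} (hK : CZK n K B) (x' : En n) (S : Set (En n))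
    (R A1 A2 : ℝ) (hR : 0 < R) (h1 : R / 2 ≤ A1) (h12 : A1 ≤ A2) (h2 : A2 ≤ 2 * R)
    (hS : S ⊆ ball x' A2 \ ball x' A1) :
    |∫ y in S, K (x' - y)| ≤ B * (((R / 2) ^ n)⁻¹ * n * (2 * R) ^ (n - 1) * ub n) * (A2 - A1) := by
  have hB := hK.nonneg
  have hf : volume (ball x' A2 \ ball x' A1) < ⊤ :=
    (measure_mono sdiff_subset).trans_lt measure_ball_lt_top
  have := norm_setIntegral_le_of_norm_le_const (f := fun y => K (x' - y)) (C := B / (R / 2) ^ n)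
    ((measure_mono hS).trans_lt hf) (fun y hy => by
      apply hK.bd (by positivity)
      have := (hS hy).2
      rw [mem_ball, not_lt, dist_comm, dist_eq_norm] at this
      linarith)
  rw [Real.norm_eq_abs] at this
  refine this.trans ?_
  have hub := ub_nonneg n
  have hd : 0 ≤ A2 - A1 := by linarith
  have hA2 : 0 ≤ A2 := by linarith
  calc B / (R / 2) ^ n * volume.real S ≤ B / (R / 2) ^ n * (n * A2 ^ (n - 1) * (A2 - A1) * ub n) := by
        gcongr
        exact (measureReal_mono hS hf.ne).trans (shell_vol hn x' A1 A2 (by linarith) h12)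
    _ ≤ B / (R / 2) ^ n * (n * (2 * R) ^ (n - 1) * (A2 - A1) * ub n) := by gcongr
    _ = _ := by ring

/-- half-space part -/
lemma CZK.halfspace {n : ℕ} (hn : 0 < n) {K : En n → ℝ} {B : ℝ} (hK : CZK n K B) (ℓ : En n →L[ℝ] ℝ)
    (hℓ : 1 ≤ ‖ℓ‖) (L : ℝ) (hL : ‖ℓ‖ ≤ L) (R : ℝ) (hR : 0 < R) (x x' : En n) (c : ℝ) (hc : 0 < ℓ x - c)
    (hxx : ‖x - x'‖ ≤ R / 2) (hxx2 : L * ‖x - x'‖ ≤ (ℓ x - c) / 2) :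
    |∫ y in ball x R ∩ {y | ℓ y < c}, (K (x - y) - K (x' - y))| ≤
      B * (JC n R * L + 2 * (((R / 2) ^ n)⁻¹ * n * (2 * R) ^ (n - 1) * ub n)) * ‖x - x'‖ := by
  set t := ℓ x - c with ht
  set H := {y : En n | ℓ y < c} with hH
  have hHm : MeasurableSet H := measurableSet_lt ℓ.measurable measurable_const
  have hℓ0 : 0 < ‖ℓ‖ := by linarith
  have hL0 : 0 < L := by linarith
  have hlip : ∀ z, |ℓ z| ≤ L * ‖z‖ := fun z => (ℓ.le_opNorm z).trans (by gcongr)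
  have htt : |t - (ℓ x' - c)| ≤ L * ‖x - x'‖ := by
    have := hlip (x - x')
    rw [map_sub] at this
    rwa [ht, sub_sub_sub_cancel_right]
  have ht' : t / 2 ≤ ℓ x' - c := by
    have := (abs_le.1 htt).2; linarith
  have hfar : ∀ y ∈ H, ∀ z, t / 2 ≤ ℓ z - c → t / (2 * L) ≤ ‖z - y‖ := by
    intro y hy z hz
    rw [div_le_iff₀ (by positivity)]
    have h1 := hlip (z - y)
    rw [map_sub] at h1
    have h2 := le_abs_self (ℓ z - ℓ y)
    have h3 : ℓ y < c := hy
    linarith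
  have hi : ∀ z u, t / 2 ≤ ℓ z - c → IntegrableOn (fun y => K (z - y)) (ball u R ∩ H) := by
    intro z u hz
    refine hK.intOn z _ (measurableSet_ball.inter hHm)
      ((measure_mono inter_subset_left).trans_lt measure_ball_lt_top).ne (a := t / (2 * L)) (by positivity) ?_
    rintro y ⟨_, hy⟩
    exact hfar y hy z hz
  rw [integral_sub (hi x x (by linarith)) (hi x' x ht'), JJ_trans]
  have e1 := integral_inter_add_sdiff (measurableSet_ball (x := x') (ε := R)) (hi x' x ht')
  have e2 := integral_inter_add_sdiff (measurableSet_ball (x := x) (ε := R)) (hi x' x' ht')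
  rw [JJ_trans] at e2
  have s : ball x R ∩ H ∩ ball x' R = ball x' R ∩ H ∩ ball x R := by
    ext; simp only [mem_inter_iff]; tauto
  rw [s] at e1
  have hJ := hK.JJ_lip hn ℓ hℓ R t (ℓ x' - c) hc hR (htt.trans hxx2)
  have b1 := hK.shell hn x' ((ball x R ∩ H) \ ball x' R) R R (R + ‖x - x'‖) hR (by linarith)
    (by linarith [norm_nonneg (x - x')]) (by linarith) (by
      rintro y ⟨⟨h1, _⟩, h2⟩
      refine ⟨?_, h2⟩
      rw [mem_ball] at h1 ⊢
      have := dist_triangle y x x'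
      rw [dist_eq_norm x x'] at this; linarith)
  have b2 := hK.shell hn x' ((ball x' R ∩ H) \ ball x R) R (R - ‖x - x'‖) R hR (by linarith)
    (by linarith [norm_nonneg (x - x')]) (by linarith) (by
      rintro y ⟨⟨h1, _⟩, h2⟩
      refine ⟨h1, ?_⟩
      rw [mem_ball, not_lt] at h2 ⊢
      have := dist_triangle y x' x
      rw [dist_comm x' x, dist_eq_norm x x'] at this; linarith)
  have hB := hK.nonneg
  have hJC : 0 ≤ JC n R := by unfold JC; positivity
  have hJ2 : |JJ K ℓ R t - JJ K ℓ R (ℓ x' - c)| ≤ B * JC n R * (L * ‖x - x'‖) :=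
    hJ.trans (by gcongr)
  rw [abs_le] at hJ2 b1 b2 ⊢
  have q1 : R + ‖x - x'‖ - R = ‖x - x'‖ := by ring
  have q2 : R - (R - ‖x - x'‖) = ‖x - x'‖ := by ring
  rw [q1] at b1
  rw [q2] at b2
  constructor <;> nlinarith [hJ2.1, hJ2.2, b1.1, b1.2, b2.1, b2.2]


/-- error between the domain and its tangent half-space -/
lemma CZK.err {n : ℕ} (hn : 0 < n) {K : En n → ℝ} {B : ℝ} (hK : CZK n K B) (ε : ℝ) (hε0 : 0 < ε)
    (hε1 : ε < 1) (ℓ : En n →L[ℝ] ℝ)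
    (hℓ : 1 ≤ ‖ℓ‖) (S : Set (En n)) (hS : MeasurableSet S) (x x' : En n) (c M τ : ℝ) (hM : 0 ≤ M)
    (hτ : 0 < τ) (hSt : ∀ y ∈ S, τ ≤ ‖x - y‖) (hxx : 2 * ‖x - x'‖ ≤ τ)
    (hSM : ∀ y ∈ S, |ℓ y - c| ≤ M * ‖x - y‖ ^ (1 + ε)) :
    |∫ y in S, (K (x - y) - K (x' - y))| ≤
      B * 2 ^ (n + 1) * ‖x - x'‖ * (dyC (n + ε) (n + 1) * (2 ^ n * M) * τ ^ (ε - 1)) := by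
  have hB := hK.nonneg
  have := dyadic_int S hS x (n + ε) (n + 1) τ (2 ^ n * M) (B * 2 ^ (n + 1) * ‖x - x'‖) (by linarith)
    (by positivity) hτ (by positivity) (by positivity) (fun ρ hρ => by
      have hρ0 : 0 < ρ := by linarith
      refine (measure_mono ?_).trans ((slab_vol hn ℓ hℓ x c ρ (M * ρ ^ (1 + ε)) hρ0.le (by positivity)).trans
        (le_of_eq ?_))
      · rintro y ⟨hy, hy2⟩
        refine ⟨hy2, (hSM y hy).trans ?_⟩
        rw [mem_ball, dist_comm, dist_eq_norm] at hy2
        gcongr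
      · congr 1
        have : ρ ^ ((n : ℝ) + ε) = ρ ^ (n - 1) * ρ ^ (1 + ε) := by
          rw [← Real.rpow_natCast, ← Real.rpow_add hρ0]
          congr 1
          rw [Nat.cast_sub (by omega)]; push_cast; ring
        rw [this]; ring) hSt (fun y => K (x - y) - K (x' - y)) (fun y hy => by
      have h1 := hSt y hy
      have h0 : 0 < ‖x - y‖ := by linarith
      refine (hK.diff x x' y (sub_ne_zero.1 (norm_pos_iff.1 h0)) (by linarith)).trans (le_of_eq ?_)
      rw [Real.rpow_neg h0.le, ← div_eq_mul_inv]
      congr 1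
      rw [← Real.rpow_natCast]; push_cast; rfl)
  rw [Real.norm_eq_abs] at this
  refine this.trans (le_of_eq ?_)
  congr 3; ring

lemma Dbound {n : ℕ} (hn : 0 < n) {Ω : Set (En n)} {ε : ℝ} (hε0 : 0 < ε) (hε1 : ε < 1)
    (hΩo : IsOpen Ω) (hΩv : volume Ω ≠ ⊤) {a : En n} {r L M : ℝ} {Φ : En n → ℝ} {e : En n}
    (ch : Chart n Ω ε a r L M Φ e) :
    ∃ C : ℝ, 0 ≤ C ∧ ∀ K B, CZK n K B → ∀ x x', x ∈ ball a (r / (4 * L)) → 0 < Φ x →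
      ‖x - x'‖ ≤ Φ x / (2 * L) →
      |∫ y in Ω, (K (x - y) - K (x' - y))| ≤ C * B * ‖x - x'‖ * Φ x ^ (ε - 1) := by
  have hL := ch.hL
  have hL0 : 0 < L := by linarith
  have hr := ch.rpos
  have hM := ch.hM
  have hd := dyC_pos (n + ε) (n + 1) (by linarith)
  set R := r / 2 with hRdef
  have hR : 0 < R := by positivity
  set C1 := JC n R * L + 2 * (((R / 2) ^ n)⁻¹ * n * (2 * R) ^ (n - 1) * ub n) with hC1
  set M' := M * (1 + L) ^ (1 + ε) with hM'
  set C2 := 2 ^ (n + 1) * (dyC (n + ε) (n + 1) * (2 ^ n * M') * L ^ (1 - ε)) with hC2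
  set C3 := 2 ^ (n + 1) / R ^ (n + 1) * volume.real Ω with hC3
  have hub := ub_nonneg n
  have hJC : 0 ≤ JC n R := by unfold JC; positivity
  have hC10 : 0 ≤ C1 := by positivity
  have hC20 : 0 ≤ C2 := by positivity
  have hC30 : 0 ≤ C3 := by positivity
  refine ⟨(C1 + C3) * r ^ (1 - ε) + 2 * C2, by positivity, ?_⟩
  intro K B hK x x' hx ht hxx
  have hB := hK.nonneg
  obtain ⟨hx4, hx5⟩ := ch.small hx
  set t := Φ x with htdef
  have htr : t ≤ r / 4 := (le_abs_self _).trans hx5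
  set h := ‖x - x'‖ with hh
  have hh0 : 0 ≤ h := norm_nonneg _
  set xb := x - t • e with hxb
  have hxxb : ‖x - xb‖ = t := by
    rw [hxb, sub_sub_cancel, norm_smul, ch.enorm, mul_one, Real.norm_of_nonneg ht.le]
  have hxbm : xb ∈ ball a r := by
    rw [mem_ball, dist_eq_norm] at hx4 ⊢
    have e1 : xb - a = (x - a) - (x - xb) := by abel
    rw [e1]
    have := norm_sub_le (x - a) (x - xb)
    linarith
  have hΦxb : Φ xb = 0 := by
    have := ch.up x (-t)
    rw [neg_smul, ← sub_eq_add_neg, ← htdef] at this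
    rw [hxb, this]; ring
  set ℓ := fderiv ℝ Φ xb with hℓ
  have hℓ1 := ch.fd_norm xb
  have hℓL := ch.lip xb hxbm
  have hlip : ∀ z, |ℓ z| ≤ L * ‖z‖ := fun z => (ℓ.le_opNorm z).trans (by gcongr)
  have hℓx : ℓ x - ℓ xb = t := by
    rw [← map_sub, hxb, sub_sub_cancel, map_smul, ch.fd_e, smul_eq_mul, mul_one]
  set H := {y : En n | ℓ y < ℓ xb} with hH
  have hHm : MeasurableSet H := measurableSet_lt ℓ.measurable measurable_const
  have hLh : L * h ≤ t / 2 := by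
    rw [le_div_iff₀ (by positivity)] at hxx; linarith
  have h2h : 2 * h ≤ t / L := by rw [le_div_iff₀ hL0]; linarith
  have hhR : h ≤ R / 4 := by
    have : h ≤ L * h := le_mul_of_one_le_left hh0 hL
    linarith
  have hfarΩ : ∀ y ∈ Ω, t / L ≤ ‖x - y‖ := fun y hy => by
    rw [div_le_iff₀ hL0, mul_comm]; exact ch.far hx hy
  have hfarH : ∀ y ∈ H, t / L ≤ ‖x - y‖ := fun y hy => by
    rw [div_le_iff₀ hL0, mul_comm]
    have h1 := hlip (x - y)
    rw [map_sub] at h1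
    have h2 := le_abs_self (ℓ x - ℓ y)
    have h3 : ℓ y < ℓ xb := hy
    linarith
  have htL : 0 < t / L := by positivity
  have hfar' : ∀ y, t / L ≤ ‖x - y‖ → t / (2 * L) ≤ ‖x' - y‖ := by
    intro y hy
    have h1 : ‖x - y‖ ≤ h + ‖x' - y‖ := by
      have := norm_add_le (x - x') (x' - y)
      rwa [sub_add_sub_cancel] at this
    have h2 : t / (2 * L) = t / L / 2 := by field_simp
    linarith
  set W := ball x R with hW
  have hWr : W ⊆ ball a r := by
    apply ball_subset_ball'
    rw [mem_ball] at hx4; linarith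
  set G : En n → ℝ := fun y => K (x - y) - K (x' - y) with hG
  have hi : ∀ S : Set (En n), MeasurableSet S → volume S ≠ ⊤ → (∀ y ∈ S, t / L ≤ ‖x - y‖) →
      IntegrableOn G S := by
    intro S hS hSf hSt
    exact (hK.intOn x S hS hSf htL hSt).sub
      (hK.intOn x' S hS hSf (by positivity) (fun y hy => hfar' y (hSt y hy)))
  have hWf : volume W ≠ ⊤ := measure_ball_lt_top.ne
  have hΩm := hΩo.measurableSet
  have d1 := integral_inter_add_sdiff (f := G) (measurableSet_ball (x := x) (ε := R)) (hi Ω hΩm hΩv hfarΩ)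
  have d2 := integral_inter_add_sdiff (f := G) hHm (hi (Ω ∩ W) (hΩm.inter measurableSet_ball)
    ((measure_mono inter_subset_left).trans_lt hΩv.lt_top).ne (fun y hy => hfarΩ y hy.1))
  have d3 := integral_inter_add_sdiff (f := G) hΩm (hi (W ∩ H) (measurableSet_ball.inter hHm)
    ((measure_mono inter_subset_left).trans_lt hWf.lt_top).ne (fun y hy => hfarH y hy.2))
  have s : W ∩ H ∩ Ω = Ω ∩ W ∩ H := by ext; simp only [mem_inter_iff]; tauto
  rw [s] at d3
  -- far part
  have b1 : |∫ y in Ω \ W, G y| ≤ B * C3 * h := by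
    have := norm_setIntegral_le_of_norm_le_const (f := G) (s := Ω \ W) (μ := volume)
      (C := B * 2 ^ (n + 1) * h / R ^ (n + 1))
      ((measure_mono sdiff_subset).trans_lt hΩv.lt_top) (fun y hy => by
        have h1 := hfarΩ y hy.1
        have h0 : 0 < ‖x - y‖ := by linarith
        have h2 := hy.2
        rw [hW, mem_ball, not_lt, dist_comm, dist_eq_norm] at h2
        refine (hK.diff x x' y (sub_ne_zero.1 (norm_pos_iff.1 h0)) (by linarith)).trans ?_
        gcongr)
    rw [Real.norm_eq_abs] at this
    refine this.trans ?_
    calc B * 2 ^ (n + 1) * h / R ^ (n + 1) * volume.real (Ω \ W)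
        ≤ B * 2 ^ (n + 1) * h / R ^ (n + 1) * volume.real Ω := by
          gcongr
          exact sdiff_subset
      _ = _ := by rw [hC3]; ring
  -- half-space part
  have b2 : |∫ y in W ∩ H, G y| ≤ B * C1 * h :=
    hK.halfspace hn ℓ hℓ1 L hℓL R hR x x' (ℓ xb) (by linarith) (by linarith) (by linarith)
  -- error parts
  have hcmp : ∀ y, t / L ≤ ‖x - y‖ → M * ‖y - xb‖ ^ (1 + ε) ≤ M' * ‖x - y‖ ^ (1 + ε) := by
    intro y hy
    have h1 : ‖y - xb‖ ≤ (1 + L) * ‖x - y‖ := by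
      have := norm_sub_le (x - xb) (x - y)
      rw [sub_sub_sub_cancel_left, hxxb] at this
      rw [div_le_iff₀ hL0] at hy
      linarith
    calc M * ‖y - xb‖ ^ (1 + ε) ≤ M * ((1 + L) * ‖x - y‖) ^ (1 + ε) := by gcongr
      _ = _ := by rw [Real.mul_rpow (by positivity) (by positivity), hM']; ring
  have hM'0 : 0 ≤ M' := by positivity
  have hexp : (t / L) ^ (ε - 1) = t ^ (ε - 1) * L ^ (1 - ε) := by
    rw [Real.div_rpow ht.le hL0.le, div_eq_mul_inv, ← Real.rpow_neg hL0.le, neg_sub]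
  have b3 : |∫ y in (Ω ∩ W) \ H, G y| ≤ B * C2 * h * t ^ (ε - 1) := by
    refine (hK.err hn ε hε0 hε1 ℓ hℓ1 ((Ω ∩ W) \ H) ((hΩm.inter measurableSet_ball).diff hHm) x x' (ℓ xb)
      M' (t / L) hM'0 htL (fun y hy => hfarΩ y hy.1.1) h2h ?_).trans (le_of_eq ?_)
    · rintro y ⟨⟨hy1, hy2⟩, hy3⟩
      refine le_trans ?_ (hcmp y (hfarΩ y hy1))
      have h1 := (ch.mem y (hWr hy2)).1 hy1
      have h2 : ℓ xb ≤ ℓ y := not_lt.1 hy3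
      have h3 := ch.taylor hε0 y xb
      rw [hΦxb, sub_zero, map_sub, ← hℓ] at h3
      rw [abs_le] at h3
      rw [abs_of_nonneg (by linarith)]
      linarith [h3.1]
    · rw [hexp, hC2]; ring
  have b4 : |∫ y in (W ∩ H) \ Ω, G y| ≤ B * C2 * h * t ^ (ε - 1) := by
    refine (hK.err hn ε hε0 hε1 ℓ hℓ1 ((W ∩ H) \ Ω) ((measurableSet_ball.inter hHm).diff hΩm) x x' (ℓ xb)
      M' (t / L) hM'0 htL (fun y hy => hfarH y hy.1.2) h2h ?_).trans (le_of_eq ?_)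
    · rintro y ⟨⟨hy1, hy2⟩, hy3⟩
      refine le_trans ?_ (hcmp y (hfarH y hy2))
      have h1 : 0 ≤ Φ y := not_lt.1 (fun h => hy3 ((ch.mem y (hWr hy1)).2 h))
      have h2 : ℓ y < ℓ xb := hy2
      have h3 := ch.taylor hε0 y xb
      rw [hΦxb, sub_zero, map_sub, ← hℓ] at h3
      rw [abs_le] at h3
      rw [abs_of_nonpos (by linarith)]
      linarith [h3.2]
    · rw [hexp, hC2]; ring
  have hone : 1 ≤ r ^ (1 - ε) * t ^ (ε - 1) := by
    have : t ^ (ε - 1) = (t ^ (1 - ε))⁻¹ := by rw [← Real.rpow_neg ht.le, neg_sub]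
    rw [this, ← div_eq_mul_inv, one_le_div (by positivity)]
    apply Real.rpow_le_rpow ht.le <;> linarith
  have hfin : B * (C1 + C3) * h ≤ B * (C1 + C3) * h * (r ^ (1 - ε) * t ^ (ε - 1)) :=
    le_mul_of_one_le_right (by positivity) hone
  have tot : |∫ y in Ω, G y| ≤ B * C1 * h + B * C3 * h + 2 * (B * C2 * h * t ^ (ε - 1)) := by
    rw [abs_le] at b1 b2 b3 b4 ⊢
    constructor <;> linarith [b1.1, b1.2, b2.1, b2.2, b3.1, b3.2, b4.1, b4.2]
  refine tot.trans ?_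
  calc _ = B * (C1 + C3) * h + 2 * (B * C2 * h * t ^ (ε - 1)) := by ring
    _ ≤ B * (C1 + C3) * h * (r ^ (1 - ε) * t ^ (ε - 1)) + 2 * (B * C2 * h * t ^ (ε - 1)) := by linarith
    _ = _ := by ring


/-- Hölder data for the density -/
structure HF (n : ℕ) (Ω : Set (En n)) (ε : ℝ) (f : En n → ℂ) (N : ℝ) : Prop where
  nonneg : 0 ≤ N
  bd : ∀ y ∈ Ω, ‖f y‖ ≤ N
  hold : ∀ y ∈ Ω, ∀ z ∈ Ω, ‖f y - f z‖ ≤ N * ‖y - z‖ ^ ε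

lemma HF.cont {n : ℕ} {Ω : Set (En n)} {ε : ℝ} (hε0 : 0 < ε) {f : En n → ℂ} {N : ℝ}
    (hf : HF n Ω ε f N) : ContinuousOn f Ω := by
  intro z hz
  rw [ContinuousWithinAt, tendsto_iff_norm_sub_tendsto_zero]
  have h1 : Tendsto (fun y : En n => N * ‖y - z‖ ^ ε) (𝓝[Ω] z) (𝓝 0) := by
    have : Continuous (fun y : En n => N * ‖y - z‖ ^ ε) := by
      apply continuous_const.mul
      exact (continuous_id.sub continuous_const).norm.rpow_const (fun _ => Or.inr hε0.le)
    have h2 := this.tendsto z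
    simp only [sub_self, norm_zero, Real.zero_rpow hε0.ne', mul_zero] at h2
    exact h2.mono_left nhdsWithin_le_nhds
  refine squeeze_zero' (Eventually.of_forall fun _ => norm_nonneg _) ?_ h1
  filter_upwards [self_mem_nhdsWithin] with y hy
  exact hf.hold y hy z hz

/-- the operator -/
def TT {n : ℕ} (Ω : Set (En n)) (K : En n → ℝ) (f : En n → ℂ) (x : En n) : ℂ :=
  ∫ y in Ω, f y * (K (x - y) : ℂ)

lemma HF.mul_int {n : ℕ} {Ω : Set (En n)} (hΩo : IsOpen Ω) {ε : ℝ} (hε0 : 0 < ε) {f : En n → ℂ} {N : ℝ}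
    (hf : HF n Ω ε f N) {G : En n → ℝ} (hG : IntegrableOn G Ω) :
    IntegrableOn (fun y => f y * (G y : ℂ)) Ω := by
  refine Integrable.bdd_mul (c := N) hG.ofReal
    ((hf.cont hε0).aestronglyMeasurable hΩo.measurableSet) ?_
  filter_upwards [ae_restrict_mem hΩo.measurableSet] with y hy
  exact hf.bd y hy

lemma star {n : ℕ} (hn : 0 < n) {Ω : Set (En n)} {ε : ℝ} (hε0 : 0 < ε) (hε1 : ε < 1)
    (hΩo : IsOpen Ω) (hΩv : volume Ω ≠ ⊤) {a : En n} {r L M : ℝ} {Φ : En n → ℝ} {e : En n}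
    (ch : Chart n Ω ε a r L M Φ e) :
    ∃ C : ℝ, 0 ≤ C ∧ ∀ K B f N, CZK n K B → HF n Ω ε f N → ∀ x x', x ∈ ball a (r / (4 * L)) → 0 < Φ x →
      ‖x - x'‖ ≤ Φ x / (2 * L) →
      ‖TT Ω K f x - TT Ω K f x'‖ ≤ C * B * N * ‖x - x'‖ ^ ε := by
  obtain ⟨C0, hC0, hD⟩ := Dbound hn hε0 hε1 hΩo hΩv ch
  have hL := ch.hL
  have hL0 : 0 < L := by linarith
  have hr := ch.rpos
  have hd := dyC_pos (n : ℝ) (n + 1 - ε) (by linarith)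
  have hub := ub_nonneg n
  have : Nonempty (Fin n) := ⟨⟨0, hn⟩⟩
  set C1 := (1 + 2 * L) ^ ε * 2 ^ (n + 1) * (dyC (n : ℝ) (n + 1 - ε) * ub n * L ^ (1 - ε)) with hC1
  have hC10 : 0 ≤ C1 := by positivity
  refine ⟨C1 + C0, by positivity, ?_⟩
  intro K B f N hK hf x x' hx ht hxx
  have hB := hK.nonneg
  have hN := hf.nonneg
  obtain ⟨hx4, hx5⟩ := ch.small hx
  have hD' := hD K B hK x x' hx ht hxx
  set t := Φ x with htdef
  have htr : t ≤ r / 4 := (le_abs_self _).trans hx5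
  set h := ‖x - x'‖ with hh
  have hh0 : 0 ≤ h := norm_nonneg _
  have hΩm := hΩo.measurableSet
  have htL : 0 < t / L := by positivity
  have h2h : 2 * h ≤ t / L := by
    rw [le_div_iff₀ (by positivity)] at hxx
    rw [le_div_iff₀ hL0]; linarith
  have hfarΩ : ∀ y ∈ Ω, t / L ≤ ‖x - y‖ := fun y hy => by
    rw [div_le_iff₀ hL0, mul_comm]; exact ch.far hx hy
  have hfar' : ∀ y ∈ Ω, t / (2 * L) ≤ ‖x' - y‖ := by
    intro y hy
    have h1 : ‖x - y‖ ≤ h + ‖x' - y‖ := by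
      have := norm_add_le (x - x') (x' - y)
      rwa [sub_add_sub_cancel] at this
    have h2 : t / (2 * L) = t / L / 2 := by field_simp
    have := hfarΩ y hy
    linarith
  set p := x - (2 * t) • e with hp
  have hxp : ‖x - p‖ = 2 * t := by
    rw [hp, sub_sub_cancel, norm_smul, ch.enorm, mul_one, Real.norm_of_nonneg (by positivity)]
  have hpΩ : p ∈ Ω := by
    rw [ch.mem p]
    · have := ch.up x (-(2 * t))
      rw [neg_smul, ← sub_eq_add_neg, ← htdef] at this
      rw [hp, this]; linarith
    · rw [mem_ball, dist_eq_norm] at hx4 ⊢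
      have e1 : p - a = (x - a) - (x - p) := by abel
      rw [e1]
      have := norm_sub_le (x - a) (x - p)
      linarith
  set G : En n → ℝ := fun y => K (x - y) - K (x' - y) with hG
  have i1 := hK.intOn x Ω hΩm hΩv htL hfarΩ
  have i2 := hK.intOn x' Ω hΩm hΩv (by positivity) hfar'
  have iG : IntegrableOn G Ω := i1.sub i2
  have e1 : TT Ω K f x - TT Ω K f x' = (∫ y in Ω, (f y - f p) * (G y : ℂ)) + f p * ((∫ y in Ω, G y : ℝ) : ℂ) := by
    unfold TT
    have hcast : ((∫ y in Ω, G y : ℝ) : ℂ) = ∫ y in Ω, (G y : ℂ) := integral_complex_ofReal.symm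
    rw [← integral_sub (hf.mul_int hΩo hε0 i1) (hf.mul_int hΩo hε0 i2), hcast,
      ← integral_const_mul, ← integral_add]
    · congr 1; ext y; simp only [hG]; push_cast; ring
    · have := (hf.mul_int hΩo hε0 iG).sub ((iG.ofReal (𝕜 := ℂ)).const_mul (f p))
      refine this.congr ?_
      filter_upwards with y
      simp only [Pi.sub_apply, sub_mul]; rfl
    · exact (iG.ofReal (𝕜 := ℂ)).const_mul (f p)
  have b1 : ‖∫ y in Ω, (f y - f p) * (G y : ℂ)‖ ≤ C1 * B * N * h * t ^ (ε - 1) := by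
    refine (dyadic_int Ω hΩm x n (n + 1 - ε) (t / L) (ub n) (N * (1 + 2 * L) ^ ε * (B * 2 ^ (n + 1) * h))
      (by linarith) (by have : (0 : ℝ) ≤ n := Nat.cast_nonneg n
                        linarith) htL hub (by positivity) ?_ hfarΩ _ ?_).trans (le_of_eq ?_)
    · intro ρ hρ
      have hρ0 : 0 ≤ ρ := by linarith
      refine (measure_mono inter_subset_right).trans ?_
      rw [Measure.addHaar_ball _ _ hρ0, mul_comm (ub n), ENNReal.ofReal_mul (by positivity), ub,
        measureReal_def, ENNReal.ofReal_toReal measure_ball_lt_top.ne]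
      simp
    · intro y hy
      have h1 := hfarΩ y hy
      have h0 : 0 < ‖x - y‖ := by linarith
      have h2 : ‖y - p‖ ≤ (1 + 2 * L) * ‖x - y‖ := by
        have := norm_sub_le (x - p) (x - y)
        rw [sub_sub_sub_cancel_left, hxp] at this
        rw [div_le_iff₀ hL0] at h1
        linarith
      have h3 := hK.diff x x' y (sub_ne_zero.1 (norm_pos_iff.1 h0)) (by linarith)
      rw [norm_mul, Complex.norm_real, Real.norm_eq_abs]
      calc ‖f y - f p‖ * |G y| ≤ (N * ((1 + 2 * L) * ‖x - y‖) ^ ε) *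
            (B * 2 ^ (n + 1) * h / ‖x - y‖ ^ (n + 1)) := by
            apply mul_le_mul _ h3 (abs_nonneg _) (by positivity)
            refine (hf.hold y hy p hpΩ).trans ?_
            gcongr
        _ = _ := by
            rw [Real.mul_rpow (by positivity) h0.le]
            have : ‖x - y‖ ^ (-((n : ℝ) + 1 - ε)) = ‖x - y‖ ^ ε / ‖x - y‖ ^ (n + 1) := by
              rw [← Real.rpow_natCast, ← Real.rpow_sub h0]; congr 1; push_cast; ring
            rw [this]; ring
    · have : (n : ℝ) - (n + 1 - ε) = ε - 1 := by ring
      rw [this, Real.div_rpow ht.le hL0.le, div_eq_mul_inv, ← Real.rpow_neg hL0.le, neg_sub, hC1]; ring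
  have b2 : ‖f p * ((∫ y in Ω, G y : ℝ) : ℂ)‖ ≤ C0 * B * N * h * t ^ (ε - 1) := by
    rw [norm_mul, Complex.norm_real, Real.norm_eq_abs]
    calc ‖f p‖ * |∫ y in Ω, G y| ≤ N * (C0 * B * h * t ^ (ε - 1)) :=
          mul_le_mul (hf.bd p hpΩ) hD' (abs_nonneg _) hN
      _ = _ := by ring
  have hht : h * t ^ (ε - 1) ≤ h ^ ε := by
    rcases hh0.eq_or_lt with h0 | h0
    · rw [← h0, Real.zero_rpow hε0.ne', zero_mul]
    · have h1 : h ≤ t := by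
        have : t / L ≤ t := div_le_self ht.le hL
        linarith
      calc h * t ^ (ε - 1) ≤ h * h ^ (ε - 1) := by
            gcongr ?_ * ?_
            exact Real.rpow_le_rpow_of_nonpos h0 h1 (by linarith)
        _ = h ^ ε := by
            rw [Real.rpow_sub_one h0.ne']; field_simp
  rw [e1]
  refine (norm_add_le _ _).trans ?_
  calc _ ≤ C1 * B * N * h * t ^ (ε - 1) + C0 * B * N * h * t ^ (ε - 1) := add_le_add b1 b2
    _ = (C1 + C0) * B * N * (h * t ^ (ε - 1)) := by ring
    _ ≤ _ := by gcongr

lemma chain_vert {n : ℕ} {Ω : Set (En n)} {ε : ℝ} (hε0 : 0 < ε) {a : En n} {r L M : ℝ}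
    {Φ : En n → ℝ} {e : En n} (ch : Chart n Ω ε a r L M Φ e) :
    ∃ C : ℝ, 0 ≤ C ∧ ∀ (F : En n → ℂ) (A : ℝ), 0 ≤ A →
      (∀ x x', x ∈ ball a (r / (4 * L)) → 0 < Φ x → ‖x - x'‖ ≤ Φ x / (2 * L) →
        ‖F x - F x'‖ ≤ A * ‖x - x'‖ ^ ε) →
      ∀ x s, 0 < Φ x → 0 ≤ s → (∀ s', 0 ≤ s' → s' ≤ s → x + s' • e ∈ ball a (r / (4 * L))) →
        ‖F (x + s • e) - F x‖ ≤ A * C * s ^ ε := by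
  have hL := ch.hL
  have hL0 : 0 < L := by linarith
  set κ := 1 / (2 * L) with hκ
  have hκ0 : 0 < κ := by positivity
  have hκ1 : κ ≤ 1 / 2 := by rw [hκ]; gcongr; linarith
  set q := 1 - κ with hq
  have hq0 : 0 < q := by linarith
  have hq1 : q < 1 := by linarith
  have hqe : q ^ ε < 1 := Real.rpow_lt_one hq0.le hq1 hε0
  have hd : 0 < 1 - q ^ ε := by linarith
  set A' := κ ^ ε / (1 - q ^ ε) with hA'
  have hA'0 : 0 ≤ A' := by positivity
  refine ⟨A' + 1, by positivity, ?_⟩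
  intro F A hA hF x s hΦ hs hball
  have hqk : ∀ k : ℕ, 0 ≤ q ^ k * s ∧ q ^ k * s ≤ s := fun k =>
    ⟨by positivity, mul_le_of_le_one_left hs (pow_le_one₀ hq0.le hq1.le)⟩
  have hind : ∀ k : ℕ, ‖F (x + s • e) - F (x + (q ^ k * s) • e)‖ ≤ A * A' * (s ^ ε - (q ^ k * s) ^ ε) := by
    intro k
    induction k with
    | zero => simp
    | succ k ih =>
      set u := q ^ k * s with hu
      have hu0 := (hqk k).1
      have e1 : q ^ (k + 1) * s = q * u := by rw [hu]; ring
      have e2 : x + u • e - (x + (q * u) • e) = (κ * u) • e := by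
        rw [add_sub_add_left_eq_sub, ← sub_smul]; congr 1; rw [hq]; ring
      have hn : ‖x + u • e - (x + (q * u) • e)‖ = κ * u := by
        rw [e2, norm_smul, ch.enorm, mul_one, Real.norm_of_nonneg (by positivity)]
      have hstep := hF (x + u • e) (x + (q * u) • e) (hball u hu0 (hqk k).2) (by rw [ch.up]; linarith)
        (by
          rw [hn, ch.up, div_eq_mul_one_div, ← hκ, mul_comm]
          gcongr; linarith)
      rw [hn, Real.mul_rpow hκ0.le hu0] at hstep
      have e3 : κ ^ ε = A' * (1 - q ^ ε) := by rw [hA']; field_simp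
      rw [e1, Real.mul_rpow hq0.le hu0]
      have := norm_sub_le_norm_sub_add_norm_sub (F (x + s • e)) (F (x + u • e)) (F (x + (q * u) • e))
      calc _ ≤ _ := this
        _ ≤ A * A' * (s ^ ε - u ^ ε) + A * (κ ^ ε * u ^ ε) := add_le_add ih hstep
        _ = _ := by rw [e3]; ring
  have hlim : Tendsto (fun k : ℕ => q ^ k * s) atTop (𝓝 0) := by
    simpa using (tendsto_pow_atTop_nhds_zero_of_lt_one hq0.le hq1).mul_const s
  have hev : ∀ᶠ k : ℕ in atTop, q ^ k * s < Φ x / (2 * L) := hlim.eventually_lt_const (by positivity)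
  obtain ⟨k, hk⟩ := hev.exists
  have h1 := hind k
  set u := q ^ k * s with hu
  have hu0 := (hqk k).1
  have hus := (hqk k).2
  have hn : ‖x - (x + u • e)‖ = u := by
    rw [sub_add_cancel_left, norm_neg, norm_smul, ch.enorm, mul_one, Real.norm_of_nonneg hu0]
  have h2 := hF x (x + u • e) (by simpa using hball 0 le_rfl hs) hΦ (by rw [hn]; exact hk.le)
  rw [hn] at h2
  have h3 := norm_sub_le_norm_sub_add_norm_sub (F (x + s • e)) (F (x + u • e)) (F x)
  rw [norm_sub_rev (F (x + u • e))] at h3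
  have h4 : u ^ ε ≤ s ^ ε := by gcongr
  have h5 : 0 ≤ u ^ ε := by positivity
  calc _ ≤ _ := h3
    _ ≤ A * A' * (s ^ ε - u ^ ε) + A * u ^ ε := add_le_add h1 h2
    _ ≤ A * A' * s ^ ε + A * s ^ ε := by gcongr; linarith
    _ = _ := by ring

lemma chain {n : ℕ} {Ω : Set (En n)} {ε : ℝ} (hε0 : 0 < ε) {a : En n} {r L M : ℝ}
    {Φ : En n → ℝ} {e : En n} (ch : Chart n Ω ε a r L M Φ e) :
    ∃ C : ℝ, 0 ≤ C ∧ ∀ (F : En n → ℂ) (A : ℝ), 0 ≤ A →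
      (∀ x x', x ∈ ball a (r / (4 * L)) → 0 < Φ x → ‖x - x'‖ ≤ Φ x / (2 * L) →
        ‖F x - F x'‖ ≤ A * ‖x - x'‖ ^ ε) →
      ∀ x x', x ∈ ball a (r / (4 * L) / (1 + 4 * L)) → x' ∈ ball a (r / (4 * L) / (1 + 4 * L)) →
        0 < Φ x → 0 < Φ x' → ‖F x - F x'‖ ≤ A * C * ‖x - x'‖ ^ ε := by
  obtain ⟨C, hC, hV⟩ := chain_vert hε0 ch
  have hL := ch.hL
  have hL0 : 0 < L := by linarith
  have hr := ch.rpos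
  refine ⟨1 + 2 * (C * (2 * L) ^ ε), by positivity, ?_⟩
  intro F A hA hF x x' hx hx' hΦ hΦ'
  set ρ := r / (4 * L) with hρ
  have hρ0 : 0 < ρ := by positivity
  set ρ' := ρ / (1 + 4 * L) with hρ'
  have hρρ : ρ' * (1 + 4 * L) = ρ := by rw [hρ']; field_simp
  have hρ'0 : 0 < ρ' := by positivity
  set h := ‖x - x'‖ with hh
  have hh0 : 0 ≤ h := norm_nonneg _
  rw [mem_ball, dist_eq_norm] at hx hx'
  by_cases hc : h ≤ Φ x / (2 * L)
  · have := hF x x' (by rw [mem_ball, dist_eq_norm]; nlinarith) hΦ hc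
    refine this.trans ?_
    gcongr
    refine le_mul_of_one_le_right hA ?_
    have : 0 ≤ C * (2 * L) ^ ε := by positivity
    linarith
  · set s := 2 * L * h with hs
    have hs0 : 0 ≤ s := by positivity
    have hh2 : h < 2 * ρ' := by
      have := norm_sub_le (x - a) (x' - a)
      rw [sub_sub_sub_cancel_right] at this
      linarith
    have hb : ∀ z : En n, ‖z - a‖ < ρ' → ∀ s', 0 ≤ s' → s' ≤ s → z + s' • e ∈ ball a ρ := by
      intro z hz s' h0 h1
      rw [mem_ball, dist_eq_norm]
      have e1 : z + s' • e - a = (z - a) + s' • e := by abel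
      rw [e1]
      have := norm_add_le (z - a) (s' • e)
      rw [norm_smul, ch.enorm, mul_one, Real.norm_of_nonneg h0] at this
      nlinarith
    have v1 := hV F A hA hF x s hΦ hs0 (hb x hx)
    have v2 := hV F A hA hF x' s hΦ' hs0 (hb x' hx')
    have e2 : x + s • e - (x' + s • e) = x - x' := by abel
    have v3 := hF (x + s • e) (x' + s • e) (hb x hx s hs0 le_rfl) (by rw [ch.up]; linarith) (by
      rw [e2, ch.up, le_div_iff₀ (by positivity), ← hh]
      linarith)
    rw [e2] at v3
    rw [hs, Real.mul_rpow (by positivity) hh0, ← hs] at v1 v2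
    have t1 := norm_sub_le_norm_sub_add_norm_sub (F x) (F (x + s • e)) (F x')
    have t2 := norm_sub_le_norm_sub_add_norm_sub (F (x + s • e)) (F (x' + s • e)) (F x')
    rw [norm_sub_rev (F x) (F (x + s • e))] at t1
    calc _ ≤ A * C * ((2 * L) ^ ε * h ^ ε) + (A * h ^ ε + A * C * ((2 * L) ^ ε * h ^ ε)) := by linarith
      _ = _ := by ring

lemma Chart.pos {n : ℕ} {Ω : Set (En n)} {ε : ℝ} {a : En n} {r L M : ℝ}
    {Φ : En n → ℝ} {e : En n} (ch : Chart n Ω ε a r L M Φ e) {x : En n} (hx : x ∈ ball a r)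
    (hxc : x ∉ closure Ω) : 0 < Φ x := by
  by_contra hneg
  push Not at hneg
  apply hxc
  have hc : Continuous (fun s : ℝ => x + (-s) • e) := by fun_prop
  have ht : Tendsto (fun s : ℝ => x + (-s) • e) (𝓝[>] 0) (𝓝 x) := by
    have := hc.tendsto 0
    simp only [neg_zero, zero_smul, add_zero] at this
    exact this.mono_left nhdsWithin_le_nhds
  refine mem_closure_of_tendsto ht ?_
  filter_upwards [self_mem_nhdsWithin, ht.eventually (isOpen_ball.mem_nhds hx)] with s hs hs2
  rw [ch.mem _ hs2, ch.up]
  have : 0 < s := hs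
  linarith

lemma Chart.not_mem {n : ℕ} {Ω : Set (En n)} {ε : ℝ} {a : En n} {r L M : ℝ}
    {Φ : En n → ℝ} {e : En n} (ch : Chart n Ω ε a r L M Φ e) {x : En n} (hx : x ∈ ball a r)
    (hxc : 0 < Φ x) : x ∉ closure Ω := by
  intro h
  rw [_root_.mem_closure_iff] at h
  obtain ⟨y, ⟨hy1, hy2⟩, hy3⟩ := h (ball a r ∩ {y | 0 < Φ y})
    (isOpen_ball.inter (isOpen_lt continuous_const ch.diff.continuous)) ⟨hx, hxc⟩
  have h1 := (ch.mem y hy1).1 hy3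
  have h2 : 0 < Φ y := hy2
  linarith

lemma localHolder {n : ℕ} (hn : 0 < n) {Ω : Set (En n)} {ε : ℝ} (hε0 : 0 < ε) (hε1 : ε < 1)
    (hΩo : IsOpen Ω) (hΩv : volume Ω ≠ ⊤) {a : En n} {r L M : ℝ} {Φ : En n → ℝ} {e : En n}
    (ch : Chart n Ω ε a r L M Φ e) :
    ∃ ρ : ℝ, 0 < ρ ∧ (∃ q ∈ ball a ρ, q ∉ closure Ω) ∧
    ∃ C : ℝ, 0 ≤ C ∧ ∀ K B f N, CZK n K B → HF n Ω ε f N → ∀ x ∈ ball a ρ, ∀ x' ∈ ball a ρ,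
      x ∉ closure Ω → x' ∉ closure Ω →
      ‖TT Ω K f x - TT Ω K f x'‖ ≤ C * B * N * ‖x - x'‖ ^ ε := by
  obtain ⟨C1, hC1, h1⟩ := star hn hε0 hε1 hΩo hΩv ch
  obtain ⟨C2, hC2, h2⟩ := chain hε0 ch
  have hL := ch.hL
  have hL0 : 0 < L := by linarith
  have hr := ch.rpos
  set ρ' := r / (4 * L) / (1 + 4 * L) with hρ'
  have hρ'0 : 0 < ρ' := by positivity
  have hρr : ρ' ≤ r := by
    rw [hρ', div_div]
    apply div_le_self hr.le
    nlinarith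
  refine ⟨ρ', hρ'0, ⟨a + (ρ' / 2) • e, ?_, ?_⟩, C1 * C2, by positivity, ?_⟩
  · rw [mem_ball, dist_eq_norm, add_sub_cancel_left, norm_smul, ch.enorm, Real.norm_of_nonneg (by positivity)]
    linarith
  · apply ch.not_mem
    · rw [mem_ball, dist_eq_norm, add_sub_cancel_left, norm_smul, ch.enorm, Real.norm_of_nonneg (by positivity)]
      linarith
    · rw [ch.up, ch.zero]; linarith
  · intro K B f N hK hf x hx x' hx' hxc hxc'
    have hB := hK.nonneg
    have hN := hf.nonneg
    refine (h2 (TT Ω K f) (C1 * B * N) (by positivity) (h1 K B f N hK hf) x x' hx hx'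
      (ch.pos (ball_subset_ball hρr hx) hxc) (ch.pos (ball_subset_ball hρr hx') hxc')).trans (le_of_eq ?_)
    ring


lemma exists_chart {n : ℕ} {ε : ℝ} (hε0 : 0 < ε) {Ω : Set (En n)} (hΩo : IsOpen Ω)
    (hn : 0 < n) {a : En n} (ha : a ∈ frontier Ω) {r : ℝ} (hr : 0 < r) (R : En n ≃ₗᵢ[ℝ] En n)
    (φ : (Fin (n - 1) → ℝ) → ℝ) (hφ : ContDiff ℝ 1 φ) (c : ℝ≥0)
    (hc : HolderOnWith c ε.toNNReal (fderiv ℝ φ) univ)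
    (hmem : Ω ∩ ball a r = {x ∈ ball a r |
        R x ⟨n - 1, Nat.sub_lt hn Nat.one_pos⟩ <
          φ fun i : Fin (n - 1) => R x (Fin.castLE (Nat.sub_le n 1) i)}) :
    ∃ L M Φ e, Chart n Ω ε a r L M Φ e := by
  set l : Fin n := ⟨n - 1, Nat.sub_lt hn Nat.one_pos⟩ with hl
  set A : En n →L[ℝ] ℝ := (EuclideanSpace.proj l : En n →L[ℝ] ℝ).comp
    (R.toContinuousLinearEquiv : En n →L[ℝ] En n) with hA
  set P : En n →L[ℝ] (Fin (n - 1) → ℝ) := ContinuousLinearMap.pi (fun i =>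
    (EuclideanSpace.proj (Fin.castLE (Nat.sub_le n 1) i) : En n →L[ℝ] ℝ).comp
    (R.toContinuousLinearEquiv : En n →L[ℝ] En n)) with hP
  set Φ : En n → ℝ := fun y => A y - φ (P y) with hΦ
  set e : En n := R.symm (EuclideanSpace.single l 1) with he
  have hAe : A e = 1 := by simp [hA, he]
  have hPe : P e = 0 := by
    ext i
    have : (Fin.castLE (Nat.sub_le n 1) i) ≠ l := by
      intro h
      have := congrArg Fin.val h
      simp [hl] at this
      have := i.2
      omega
    simp [hP, he, this]
  have hφd : Differentiable ℝ φ := hφ.differentiable (by norm_num)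
  have hfd : ∀ y, HasFDerivAt Φ (A - (fderiv ℝ φ (P y)).comp P) y := by
    intro y
    exact A.hasFDerivAt.sub ((hφd (P y)).hasFDerivAt.comp y P.hasFDerivAt)
  have hhold : ∀ y z, ‖fderiv ℝ Φ y - fderiv ℝ Φ z‖ ≤ (c * ‖P‖ ^ ε * ‖P‖) * ‖y - z‖ ^ ε := by
    intro y z
    rw [(hfd y).fderiv, (hfd z).fderiv]
    have e1 : (A - (fderiv ℝ φ (P y)).comp P) - (A - (fderiv ℝ φ (P z)).comp P)
      = (fderiv ℝ φ (P z) - fderiv ℝ φ (P y)).comp P := by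
      rw [ContinuousLinearMap.sub_comp]; abel
    rw [e1]
    have h1 : ‖fderiv ℝ φ (P z) - fderiv ℝ φ (P y)‖ ≤ c * ‖P z - P y‖ ^ ε := by
      have := hc.dist_le (mem_univ (P z)) (mem_univ (P y))
      rwa [dist_eq_norm, dist_eq_norm, Real.coe_toNNReal _ hε0.le] at this
    have h2 : ‖P z - P y‖ ≤ ‖P‖ * ‖y - z‖ := by
      rw [← map_sub, norm_sub_rev y z]; exact P.le_opNorm _
    have h3 : ‖P z - P y‖ ^ ε ≤ ‖P‖ ^ ε * ‖y - z‖ ^ ε := by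
      rw [← Real.mul_rpow (norm_nonneg _) (norm_nonneg _)]
      exact Real.rpow_le_rpow (norm_nonneg _) h2 hε0.le
    calc ‖(fderiv ℝ φ (P z) - fderiv ℝ φ (P y)).comp P‖
        ≤ ‖fderiv ℝ φ (P z) - fderiv ℝ φ (P y)‖ * ‖P‖ := ContinuousLinearMap.opNorm_comp_le _ _
      _ ≤ (c * (‖P‖ ^ ε * ‖y - z‖ ^ ε)) * ‖P‖ := by
          gcongr
          exact h1.trans (by gcongr)
      _ = _ := by ring
  have hmem' : ∀ y ∈ ball a r, (y ∈ Ω ↔ Φ y < 0) := by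
    intro y hy
    have : y ∈ Ω ∩ ball a r ↔ y ∈ {x ∈ ball a r |
        R x l < φ fun i : Fin (n - 1) => R x (Fin.castLE (Nat.sub_le n 1) i)} := by rw [hmem]
    have h2 : y ∈ Ω ↔ R y l < φ fun i : Fin (n - 1) => R y (Fin.castLE (Nat.sub_le n 1) i) := by
      constructor
      · intro h
        exact (this.1 ⟨h, hy⟩).2
      · intro h
        exact (this.2 ⟨hy, h⟩).1
    rw [h2, ← sub_neg]
    rfl
  have hcont : Continuous Φ := by
    rw [continuous_iff_continuousAt]; exact fun y => (hfd y).continuousAt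
  refine ⟨max 1 (‖fderiv ℝ Φ a‖ + (c * ‖P‖ ^ ε * ‖P‖) * r ^ ε), c * ‖P‖ ^ ε * ‖P‖, Φ, e, ?_⟩
  have hM : 0 ≤ (c : ℝ) * ‖P‖ ^ ε * ‖P‖ := by positivity
  refine ⟨hr, le_max_left _ _, hM, ?_, fun y => (hfd y).differentiableAt, hhold, ?_, ?_, hmem', ?_⟩
  · simp [he]
  · intro y s
    simp only [hΦ, map_add, map_smul, hAe, hPe, smul_zero, add_zero, smul_eq_mul, mul_one]
    ring
  · intro y hy
    refine le_trans ?_ (le_max_right _ _)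
    have h1 := hhold y a
    have h2 : ‖y - a‖ ^ ε ≤ r ^ ε := by
      apply Real.rpow_le_rpow (norm_nonneg _) _ hε0.le
      rw [mem_ball, dist_eq_norm] at hy; exact hy.le
    have h3 : ‖fderiv ℝ Φ y‖ ≤ ‖fderiv ℝ Φ a‖ + ‖fderiv ℝ Φ y - fderiv ℝ Φ a‖ := by
      have := norm_add_le (fderiv ℝ Φ a) (fderiv ℝ Φ y - fderiv ℝ Φ a)
      rwa [add_sub_cancel] at this
    have := mul_le_mul_of_nonneg_left h2 hM
    linarith
  · apply le_antisymm
    · by_contra! h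
      have hnb : {y | 0 < Φ y} ∩ ball a r ∈ 𝓝 a :=
        Filter.inter_mem (hcont.continuousAt.eventually (lt_mem_nhds h)) (ball_mem_nhds a hr)
      obtain ⟨y, hy, hyΩ⟩ := mem_closure_iff_nhds.1 (frontier_subset_closure ha) _ hnb
      have := (hmem' y hy.2).1 hyΩ
      have h3 : 0 < Φ y := hy.1
      linarith
    · by_contra! h
      have := (hmem' a (mem_ball_self hr)).2 h
      rw [hΩo.frontier_eq] at ha
      exact ha.2 this

lemma avg_zero {n : ℕ} (μ ν : Measure (En n)) [IsFiniteMeasure μ] [IsFiniteMeasure ν]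
    (hμ0 : μ ≠ 0) (hμs : ∀ᵐ x ∂μ, x ∈ sphere (0 : En n) 1)
    (hμR : ∀ R : En n ≃ₗᵢ[ℝ] En n, MeasurePreserving R μ μ)
    (hν0 : ∀ᵐ y ∂ν, y ≠ 0)
    (hνR : ∀ R : En n ≃ₗᵢ[ℝ] En n, MeasurePreserving R ν ν)
    (w : En n → ℝ) (hwm : Measurable w) (W : ℝ) (hw0 : ∀ y, 0 ≤ w y) (hwW : ∀ y, w y ≤ W)
    (hwR : ∀ R : En n ≃ₗᵢ[ℝ] En n, ∀ y, w (R y) = w y)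
    (ω : En n → ℝ) (hωm : Measurable ω) (hωc : ContinuousOn ω (sphere 0 1))
    (hωh : ∀ t : ℝ, 0 < t → ∀ x, ω (t • x) = ω x)
    (h0 : ∫ x, ω x ∂μ = 0) : ∫ y, w y * ω y ∂ν = 0 := by
  -- a base point on the sphere
  have hne : (sphere (0 : En n) 1).Nonempty := by
    by_contra h
    rw [not_nonempty_iff_eq_empty] at h
    rw [h] at hμs
    simp at hμs
    exact hμ0 hμs
  obtain ⟨x0, hx0⟩ := hne
  rw [mem_sphere_zero_iff_norm] at hx0
  -- bound
  obtain ⟨M1, hM1⟩ := (isCompact_sphere (0 : En n) 1).exists_bound_of_continuousOn hωc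
  set M := max M1 |ω 0| with hM
  have hωb : ∀ y, |ω y| ≤ M := by
    intro y
    by_cases hy : y = 0
    · rw [hy]; exact le_max_right _ _
    · have hy' : 0 < ‖y‖ := norm_pos_iff.2 hy
      rw [← hωh (‖y‖⁻¹) (by positivity) y]
      refine le_trans (hM1 _ ?_) (le_max_left _ _)
      rw [mem_sphere_zero_iff_norm, norm_smul, norm_inv, norm_norm, inv_mul_cancel₀ hy'.ne']
  have hM0 : 0 ≤ M := (abs_nonneg _).trans (hωb 0)
  have hW0 : 0 ≤ W := (hw0 0).trans (hwW 0)
  set u : En n → En n := fun y => ‖y‖⁻¹ • y with hu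
  have hum : Measurable u := by fun_prop
  have huR : ∀ R : En n ≃ₗᵢ[ℝ] En n, ∀ y, u (R y) = R (u y) := by
    intro R y; simp [hu]
  have hu1 : ∀ y, y ≠ 0 → ‖u y‖ = 1 := by
    intro y hy
    have hy' : 0 < ‖y‖ := norm_pos_iff.2 hy
    rw [hu]; simp only
    rw [norm_smul, norm_inv, norm_norm, inv_mul_cancel₀ hy'.ne']
  have hωu : ∀ y, y ≠ 0 → ω (u y) = ω y := by
    intro y hy
    have hy' : 0 < ‖y‖ := norm_pos_iff.2 hy
    exact hωh _ (by positivity) y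
  set J := ∫ y, w y * ω y ∂ν with hJ
  set V := ∫ y, w y ∂ν with hV
  have hV0 : 0 ≤ V := integral_nonneg hw0
  -- main estimate
  have main : ∀ δ : ℝ, 0 < δ → |J| ≤ δ * V := by
    intro δ hδ
    have huc : UniformContinuousOn ω (sphere 0 1) :=
      (isCompact_sphere (0 : En n) 1).uniformContinuousOn_of_continuous hωc
    obtain ⟨r, hr, hrδ⟩ := Metric.uniformContinuousOn_iff.1 huc δ hδ
    set k : En n → En n → ℝ := fun x y => (Iio r).indicator (fun _ => (1:ℝ)) ‖x - u y‖ with hk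
    have hk0 : ∀ x y, 0 ≤ k x y := fun x y => indicator_nonneg (fun _ _ => zero_le_one) _
    have hk1 : ∀ x y, k x y ≤ 1 := fun x y => indicator_le_self' (fun _ _ => zero_le_one) _ |>.trans le_rfl
    have hkm : Measurable (fun p : En n × En n => k p.1 p.2) := by
      apply (measurable_const.indicator measurableSet_Iio).comp
      fun_prop
    have hkR : ∀ R : En n ≃ₗᵢ[ℝ] En n, ∀ x y, k (R x) (R y) = k x y := by
      intro R x y
      simp only [hk]
      rw [huR, ← map_sub, R.norm_map]
    set c1 := ∫ y, k x0 y * w y ∂ν with hc1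
    set c2 := ∫ x, k x x0 ∂μ with hc2
    have hux0 : u x0 = x0 := by simp [hu, hx0]
    have e1 : ∀ x, ‖x‖ = 1 → ∫ y, k x y * w y ∂ν = c1 := by
      intro x hx
      obtain ⟨R, hR⟩ := exists_rot x0 x (hx0.trans hx.symm)
      rw [← (hνR R).integral_comp' (f := R.toHomeomorph.toMeasurableEquiv)]
      rw [hc1]
      congr 1; ext y
      show k x (R y) * w (R y) = _
      rw [← hR, hkR, hwR]
    have e2 : ∀ y, y ≠ 0 → ∫ x, k x y ∂μ = c2 := by
      intro y hy
      obtain ⟨R, hR⟩ := exists_rot x0 (u y) (hx0.trans (hu1 y hy).symm)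
      rw [← (hμR R).integral_comp' (f := R.toHomeomorph.toMeasurableEquiv)]
      rw [hc2]
      congr 1; ext x
      show k (R x) y = _
      rw [← hkR R x x0]
      simp only [hk]
      rw [huR, hux0, hR]
    have hc2pos : 0 < c2 := by
      have h1 : c2 = μ.real (ball x0 r) := by
        rw [hc2, ← integral_indicator_one measurableSet_ball]
        congr 1; ext x
        simp only [hk, hux0, indicator, mem_Iio, mem_ball, dist_eq_norm, Pi.one_apply]
      rw [h1]
      by_contra! hneg
      have hz : μ (ball x0 r) = 0 := by
        have : μ.real (ball x0 r) = 0 := le_antisymm hneg measureReal_nonneg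
        rwa [measureReal_eq_zero_iff] at this
      have hall : ∀ x ∈ sphere (0 : En n) 1, ∃ s ∈ 𝓝[sphere (0 : En n) 1] x, μ s = 0 := by
        intro x hx
        rw [mem_sphere_zero_iff_norm] at hx
        refine ⟨ball x r, mem_nhdsWithin_of_mem_nhds (ball_mem_nhds x hr), ?_⟩
        obtain ⟨R, hR⟩ := exists_rot x0 x (hx0.trans hx.symm)
        rw [← (hμR R).measure_preimage measurableSet_ball.nullMeasurableSet, ← hR]
        convert hz using 2
        ext z
        simp [mem_ball]
      have := (isCompact_sphere (0 : En n) 1).measure_zero_of_nhdsWithin hall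
      apply hμ0
      rw [← Measure.measure_univ_eq_zero]
      refine measure_mono_null (t := sphere (0 : En n) 1 ∪ (sphere (0 : En n) 1)ᶜ) (by simp) ?_
      exact measure_union_null this hμs
    -- integrability
    have iA : Integrable (fun p : En n × En n => k p.1 p.2 * w p.2 * ω p.1) (μ.prod ν) := by
      refine Integrable.of_bound (C := 1 * W * M) ?_ ?_
      · apply Measurable.aestronglyMeasurable
        exact (hkm.mul (hwm.comp measurable_snd)).mul (hωm.comp measurable_fst)
      · filter_upwards with p
        rw [Real.norm_eq_abs, abs_mul, abs_mul, abs_of_nonneg (hk0 _ _), abs_of_nonneg (hw0 _)]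
        gcongr
        · exact hw0 _
        · exact hk1 _ _
        · exact hwW _
        · exact hωb _
    have iB : Integrable (fun p : En n × En n => k p.1 p.2 * w p.2 * ω p.2) (μ.prod ν) := by
      refine Integrable.of_bound (C := 1 * W * M) ?_ ?_
      · apply Measurable.aestronglyMeasurable
        exact (hkm.mul (hwm.comp measurable_snd)).mul (hωm.comp measurable_snd)
      · filter_upwards with p
        rw [Real.norm_eq_abs, abs_mul, abs_mul, abs_of_nonneg (hk0 _ _), abs_of_nonneg (hw0 _)]
        gcongr
        · exact hw0 _
        · exact hk1 _ _
        · exact hwW _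
        · exact hωb _
    have iC : Integrable (fun p : En n × En n => k p.1 p.2 * w p.2) (μ.prod ν) := by
      refine Integrable.of_bound (C := 1 * W) ?_ ?_
      · apply Measurable.aestronglyMeasurable
        exact (hkm.mul (hwm.comp measurable_snd))
      · filter_upwards with p
        rw [Real.norm_eq_abs, abs_mul, abs_of_nonneg (hk0 _ _), abs_of_nonneg (hw0 _)]
        gcongr
        · exact hw0 _
        · exact hk1 _ _
        · exact hwW _
    have vA : ∫ p, k p.1 p.2 * w p.2 * ω p.1 ∂(μ.prod ν) = 0 := by
      rw [integral_prod _ iA]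
      have : ∀ᵐ x ∂μ, ∫ y, k x y * w y * ω x ∂ν = c1 * ω x := by
        filter_upwards [hμs] with x hx
        rw [integral_mul_const, e1 x (mem_sphere_zero_iff_norm.1 hx)]
      rw [integral_congr_ae this, integral_const_mul, h0, mul_zero]
    have vB : ∫ p, k p.1 p.2 * w p.2 * ω p.2 ∂(μ.prod ν) = c2 * J := by
      rw [integral_prod_symm _ iB]
      have : ∀ᵐ y ∂ν, ∫ x, k x y * w y * ω y ∂μ = c2 * (w y * ω y) := by
        filter_upwards [hν0] with y hy
        rw [integral_mul_const, integral_mul_const, e2 y hy, mul_assoc]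
      rw [integral_congr_ae this, integral_const_mul]
    have vC : ∫ p, k p.1 p.2 * w p.2 ∂(μ.prod ν) = c2 * V := by
      rw [integral_prod_symm _ iC]
      have : ∀ᵐ y ∂ν, ∫ x, k x y * w y ∂μ = c2 * (w y) := by
        filter_upwards [hν0] with y hy
        rw [integral_mul_const, e2 y hy]
      rw [integral_congr_ae this, integral_const_mul]
    have a1 : ∀ᵐ p ∂(μ.prod ν), p.1 ∈ sphere (0 : En n) 1 :=
      Measure.quasiMeasurePreserving_fst.ae hμs
    have a2 : ∀ᵐ p ∂(μ.prod ν), p.2 ≠ (0 : En n) :=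
      Measure.quasiMeasurePreserving_snd.ae hν0
    have key : |c2 * J| ≤ δ * (c2 * V) := by
      rw [← vC, ← vB, ← integral_const_mul, ← abs_neg, ← zero_sub, ← vA, ← integral_sub iA iB]
      rw [← Real.norm_eq_abs]
      refine norm_integral_le_of_norm_le (iC.const_mul δ) ?_
      filter_upwards [a1, a2] with p h1 h2
      rw [← mul_sub, norm_mul, Real.norm_of_nonneg (mul_nonneg (hk0 _ _) (hw0 _))]
      by_cases hc : ‖p.1 - u p.2‖ < r
      · have h3 : u p.2 ∈ sphere (0 : En n) 1 := by
          rw [mem_sphere_zero_iff_norm]; exact hu1 _ h2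
        have := hrδ p.1 h1 (u p.2) h3 (by rwa [dist_eq_norm])
        rw [hωu _ h2, dist_eq_norm] at this
        rw [mul_comm]
        exact mul_le_mul_of_nonneg_right this.le (mul_nonneg (hk0 _ _) (hw0 _))
      · have : k p.1 p.2 = 0 := by simp only [hk]; exact indicator_of_notMem (s := Iio r) hc (fun _ => (1:ℝ))
        simp [this]
    rw [abs_mul, abs_of_pos hc2pos] at key
    have : c2 * |J| ≤ c2 * (δ * V) := by linarith [key]
    exact le_of_mul_le_mul_left this hc2pos
  have : |J| ≤ 0 := by
    apply le_of_forall_pos_le_add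
    intro η hη
    have := main (η / (V + 1)) (by positivity)
    have h2 : η / (V + 1) * V ≤ η := by
      rw [div_mul_eq_mul_div, div_le_iff₀ (by positivity)]
      nlinarith
    linarith
  exact abs_nonpos_iff.1 this

lemma normalize_lip {E : Type*} [NormedAddCommGroup E] [NormedSpace ℝ E] (x y : E)
    (hx : 1 ≤ ‖x‖) (hy : 1 ≤ ‖y‖) : ‖‖x‖⁻¹ • x - ‖y‖⁻¹ • y‖ ≤ 2 * ‖x - y‖ := by
  have hx0 : 0 < ‖x‖ := by linarith
  have hy0 : 0 < ‖y‖ := by linarith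
  have e1 : ‖x‖⁻¹ • x - ‖y‖⁻¹ • y = ‖x‖⁻¹ • (x - y) + (‖x‖⁻¹ - ‖y‖⁻¹) • y := by
    rw [smul_sub, sub_smul]; abel
  have h1 : ‖‖x‖⁻¹ • (x - y)‖ ≤ ‖x - y‖ := by
    rw [norm_smul, norm_inv, norm_norm]
    exact mul_le_of_le_one_left (norm_nonneg _) (inv_le_one_of_one_le₀ hx)
  have h2 : ‖(‖x‖⁻¹ - ‖y‖⁻¹) • y‖ ≤ ‖x - y‖ := by
    have e2 : (‖x‖⁻¹ - ‖y‖⁻¹) = ‖x‖⁻¹ * (‖y‖ - ‖x‖) * ‖y‖⁻¹ := by field_simp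
    rw [norm_smul, e2, norm_mul, norm_mul, norm_inv, norm_inv, norm_norm, norm_norm, mul_assoc,
      inv_mul_cancel₀ hy0.ne', mul_one, norm_sub_rev x y]
    refine (mul_le_of_le_one_left (norm_nonneg _) (inv_le_one_of_one_le₀ hx)).trans ?_
    exact abs_norm_sub_norm_le _ _
  rw [e1]
  refine (norm_add_le _ _).trans ?_
  linarith

lemma sphere_haus_lt_top (m : ℕ) : μH[(m : ℝ)] (sphere (0 : En (m + 1)) 1) < ⊤ := by
  set ι : (Fin m → ℝ) →L[ℝ] En (m + 1) := ∑ i, (ContinuousLinearMap.proj i : (Fin m → ℝ) →L[ℝ] ℝ).smulRight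
    (EuclideanSpace.single i.castSucc (1 : ℝ)) with hι
  have hι1 : ∀ u (j : Fin m), ι u j.castSucc = u j := by
    intro u j
    simp [hι, Finset.sum_apply, Pi.single_apply]
  have hι2 : ∀ u, ι u (Fin.last m) = 0 := by
    intro u
    simp [hι, Finset.sum_apply, Pi.single_apply]
  set e : En (m + 1) := EuclideanSpace.single (Fin.last m) 1 with he
  set G : (Fin m → ℝ) → En (m + 1) := fun u => e + ι u with hG
  have hGl : ∀ u, G u (Fin.last m) = 1 := by intro u; simp [hG, he, hι2]
  have hG1 : ∀ u, 1 ≤ ‖G u‖ := by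
    intro u
    have := PiLp.norm_apply_le (G u) (Fin.last m)
    rw [hGl] at this; simpa using this
  set g : (Fin m → ℝ) → En (m + 1) := fun u => ‖G u‖⁻¹ • G u with hg
  have hlip : LipschitzWith (2 * ‖ι‖₊) g := by
    apply LipschitzWith.of_dist_le_mul
    intro u v
    rw [dist_eq_norm, dist_eq_norm]
    refine (normalize_lip _ _ (hG1 u) (hG1 v)).trans ?_
    have : G u - G v = ι (u - v) := by simp [hG]
    rw [this]
    have := ι.le_opNorm (u - v)
    push_cast
    linarith
  set cap : Set (En (m + 1)) := {x | ‖x‖ = 1 ∧ 1 / 2 < x (Fin.last m)} with hcap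
  have hcapsub : cap ⊆ g '' (closedBall 0 2) := by
    rintro x ⟨hx1, hx2⟩
    have hx0 : 0 < x (Fin.last m) := by linarith
    refine ⟨fun i => (x (Fin.last m))⁻¹ * x i.castSucc, ?_, ?_⟩
    · rw [mem_closedBall_zero_iff, pi_norm_le_iff_of_nonneg (by norm_num)]
      intro i
      rw [norm_mul, norm_inv, Real.norm_of_nonneg hx0.le]
      have h1 := PiLp.norm_apply_le x i.castSucc
      rw [hx1] at h1
      rw [inv_mul_le_iff₀ hx0]
      linarith
    · have : G (fun i => (x (Fin.last m))⁻¹ * x i.castSucc) = (x (Fin.last m))⁻¹ • x := by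
        ext j
        refine Fin.lastCases ?_ (fun i => ?_) j
        · rw [hGl]; simp [hx0.ne']
        · have h3 : e i.castSucc = 0 := by simp [he]
          have : G (fun i => (x (Fin.last m))⁻¹ * x i.castSucc) i.castSucc =
            e i.castSucc + ι (fun i => (x (Fin.last m))⁻¹ * x i.castSucc) i.castSucc := rfl
          rw [this, hι1, h3]; simp
      simp only [hg]
      rw [this, norm_smul, hx1, mul_one, norm_inv, Real.norm_of_nonneg hx0.le, inv_inv, smul_smul,
        mul_inv_cancel₀ hx0.ne', one_smul]
  have hvol : μH[(m : ℝ)] (closedBall (0 : Fin m → ℝ) 2) < ⊤ := by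
    have := hausdorffMeasure_pi_real (ι := Fin m)
    rw [Fintype.card_fin] at this
    rw [this]
    exact measure_closedBall_lt_top
  have hcapfin : μH[(m : ℝ)] cap < ⊤ := by
    refine (measure_mono hcapsub).trans_lt ?_
    refine (hlip.hausdorffMeasure_image_le (Nat.cast_nonneg m) _).trans_lt ?_
    refine ENNReal.mul_lt_top ?_ hvol
    exact ENNReal.rpow_lt_top_of_nonneg (Nat.cast_nonneg m) ENNReal.coe_ne_top
  apply (isCompact_sphere (0 : En (m + 1)) 1).measure_lt_top_of_nhdsWithin
  intro x hx
  rw [mem_sphere_zero_iff_norm] at hx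
  obtain ⟨R, hR⟩ := exists_rot x e (by rw [hx, he]; simp)
  refine ⟨R ⁻¹' cap, ?_, ?_⟩
  · rw [mem_nhdsWithin]
    refine ⟨{z | 1 / 2 < (R z) (Fin.last m)}, ?_, ?_, ?_⟩
    · apply isOpen_lt continuous_const
      exact (EuclideanSpace.proj (Fin.last m) : En (m + 1) →L[ℝ] ℝ).continuous.comp R.continuous
    · show 1 / 2 < (R x) (Fin.last m)
      rw [hR, he]; simp; norm_num
    · rintro z ⟨hz1, hz2⟩
      refine ⟨?_, hz1⟩
      rw [R.norm_map]; exact mem_sphere_zero_iff_norm.1 hz2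
  · have := R.toIsometryEquiv.hausdorffMeasure_preimage (m : ℝ) cap
    have h2 : R.toIsometryEquiv ⁻¹' cap = R ⁻¹' cap := rfl
    rw [h2] at this
    rw [this]; exact hcapfin

lemma sphere_haus_pos (m : ℕ) : μH[(m : ℝ)] (sphere (0 : En (m + 1)) 1) ≠ 0 := by
  intro h0
  set P : En (m + 1) → (Fin m → ℝ) := fun x i => x i.castSucc with hP
  have hlip : LipschitzWith 1 P := by
    apply LipschitzWith.of_dist_le_mul
    intro x y
    rw [NNReal.coe_one, one_mul, dist_eq_norm, dist_eq_norm, pi_norm_le_iff_of_nonneg (norm_nonneg _)]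
    intro i
    exact PiLp.norm_apply_le (x - y) i.castSucc
  have h1 := hlip.hausdorffMeasure_image_le (Nat.cast_nonneg m : (0:ℝ) ≤ m) (sphere (0 : En (m + 1)) 1)
  rw [h0, mul_zero] at h1
  have hsub : ball (0 : Fin m → ℝ) (1 / (m + 1)) ⊆ P '' sphere (0 : En (m + 1)) 1 := by
    intro u hu
    rw [mem_ball_zero_iff] at hu
    have hs : ∑ i, u i ^ 2 ≤ 1 := by
      have : ∀ i ∈ (Finset.univ : Finset (Fin m)), u i ^ 2 ≤ 1 / (m + 1) := by
        intro i _
        have h2 := norm_le_pi_norm u i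
        rw [Real.norm_eq_abs] at h2
        have h3 : |u i| ≤ 1 / (m + 1) := by linarith
        have h4 : (1 : ℝ) / (m + 1) ≤ 1 := by
          rw [div_le_one (by positivity)]
          have : (0:ℝ) ≤ m := Nat.cast_nonneg m
          linarith
        rw [← sq_abs]
        nlinarith [abs_nonneg (u i)]
      refine (Finset.sum_le_sum this).trans ?_
      rw [Finset.sum_const, Finset.card_univ, Fintype.card_fin, nsmul_eq_mul, mul_one_div,
        div_le_one (by positivity)]
      linarith
    refine ⟨WithLp.toLp 2 (Fin.snoc u (√(1 - ∑ i, u i ^ 2)) : Fin (m + 1) → ℝ), ?_, ?_⟩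
    · rw [mem_sphere_zero_iff_norm, EuclideanSpace.norm_eq, Real.sqrt_eq_one, Fin.sum_univ_castSucc]
      simp [Fin.snoc_castSucc, Fin.snoc_last, Real.sq_sqrt (sub_nonneg.2 hs)]
    · ext i
      simp [hP]
  have h2 : μH[(m : ℝ)] (ball (0 : Fin m → ℝ) (1 / (m + 1))) = 0 :=
    le_antisymm ((measure_mono hsub).trans h1) (zero_le)
  have := hausdorffMeasure_pi_real (ι := Fin m)
  rw [Fintype.card_fin] at this
  rw [this] at h2
  exact (measure_ball_pos volume (0 : Fin m → ℝ) (by positivity)).ne' h2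

lemma mean_zero {n : ℕ} (hn : 0 < n) (ω K : En n → ℝ)
    (hK : ∀ x, x ≠ 0 → K x = ω x / ‖x‖ ^ n)
    (hωh : ∀ t : ℝ, 0 < t → ∀ x, ω (t • x) = ω x)
    (hωs : ContDiffOn ℝ 1 ω {(0 : En n)}ᶜ)
    (h0 : (∫ ξ in sphere (0 : En n) 1, ω ξ ∂μH[(n : ℝ) - 1]) = 0)
    (a b : ℝ) (ha : 0 < a) : ∫ z in ball (0 : En n) b \ ball 0 a, K z = 0 := by
  obtain ⟨m, rfl⟩ : ∃ m, n = m + 1 := ⟨n - 1, by omega⟩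
  have hm : ((m + 1 : ℕ) : ℝ) - 1 = m := by push_cast; ring
  rw [hm] at h0
  set A : Set (En (m + 1)) := ball 0 b \ ball 0 a with hA
  have hAm : MeasurableSet A := measurableSet_ball.diff measurableSet_ball
  have hA0 : ∀ z ∈ A, a ≤ ‖z‖ := by
    intro z hz
    have := hz.2
    rw [mem_ball_zero_iff, not_lt] at this; exact this
  set μ : Measure (En (m + 1)) := (μH[(m : ℝ)]).restrict (sphere 0 1) with hμ
  set ν : Measure (En (m + 1)) := volume.restrict A with hν
  have : IsFiniteMeasure μ := ⟨by rw [hμ, Measure.restrict_apply_univ]; exact sphere_haus_lt_top m⟩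
  have : IsFiniteMeasure ν := ⟨by
    rw [hν, Measure.restrict_apply_univ]
    exact (measure_mono sdiff_subset).trans_lt measure_ball_lt_top⟩
  have key := avg_zero μ ν (by
      intro h
      apply sphere_haus_pos m
      rw [← Measure.restrict_apply_univ, ← hμ, h]; rfl)
    (ae_restrict_mem isClosed_sphere.measurableSet) (by
      intro R
      have := (R.toIsometryEquiv.measurePreserving_hausdorffMeasure (m : ℝ)).restrict_preimage
        (isClosed_sphere (x := (0 : En (m + 1))) (ε := 1)).measurableSet
      have h2 : R.toIsometryEquiv ⁻¹' (sphere (0 : En (m + 1)) 1) = sphere 0 1 := by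
        ext z; simp
      rw [h2] at this
      exact this)
    (by
      filter_upwards [ae_restrict_mem hAm] with z hz h
      have := hA0 z hz
      rw [h, norm_zero] at this; linarith)
    (by
      intro R
      have := (R.measurePreserving).restrict_preimage hAm
      have h2 : R ⁻¹' A = A := by
        ext z; simp [hA]
      rw [h2] at this
      exact this)
    (fun y => (max a ‖y‖ ^ (m + 1))⁻¹) (by fun_prop) ((a ^ (m + 1))⁻¹)
    (fun y => by positivity) (fun y => by
      gcongr; exact le_max_left _ _) (fun R y => by simp)
    ω (measurable_of_continuousOn_compl_singleton 0 hωs.continuousOn)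
    (hωs.continuousOn.mono (fun x hx h => by
      rw [mem_sphere_zero_iff_norm] at hx
      rw [mem_singleton_iff] at h
      rw [h, norm_zero] at hx; norm_num at hx)) hωh h0
  rw [← key]
  apply setIntegral_congr_fun hAm
  intro z hz
  have h1 := hA0 z hz
  have hz0 : z ≠ 0 := by
    intro h; rw [h, norm_zero] at h1; linarith
  simp only
  rw [hK z hz0, max_eq_right h1, div_eq_inv_mul]

lemma TT_far {n : ℕ} {Ω : Set (En n)} (hΩv : volume Ω ≠ ⊤) {ε : ℝ}
    {K : En n → ℝ} {B N : ℝ} {f : En n → ℂ} (hK : CZK n K B) (hf : HF n Ω ε f N)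
    {x : En n} {η : ℝ} (hη : 0 < η) (h : ∀ y ∈ Ω, η ≤ ‖x - y‖) :
    ‖TT Ω K f x‖ ≤ volume.real Ω / η ^ n * B * N := by
  have h1 := norm_setIntegral_le_of_norm_le_const (μ := volume) (s := Ω) (C := N * (B / η ^ n))
    (f := fun y => f y * (K (x - y) : ℂ)) hΩv.lt_top (by
      intro y hy
      rw [norm_mul, Complex.norm_real, Real.norm_eq_abs]
      exact mul_le_mul (hf.bd y hy) (hK.bd hη (h y hy)) (abs_nonneg _) hf.nonneg)
  refine h1.trans (le_of_eq ?_)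
  ring

lemma far_of_notMem {n : ℕ} {Ω : Set (En n)} {x : En n} (hx : x ∉ closure Ω) :
    ∃ η : ℝ, 0 < η ∧ ∀ y ∈ Ω, η ≤ ‖x - y‖ := by
  have : (closure Ω)ᶜ ∈ 𝓝 x := isClosed_closure.isOpen_compl.mem_nhds hx
  obtain ⟨η, hη, hb⟩ := Metric.mem_nhds_iff.1 this
  refine ⟨η, hη, fun y hy => ?_⟩
  by_contra! hlt
  exact hb (by rw [mem_ball, dist_comm, dist_eq_norm]; exact hlt) (subset_closure hy)

lemma TT_diff_far {n : ℕ} {Ω : Set (En n)} (hΩo : IsOpen Ω) (hΩv : volume Ω ≠ ⊤) {ε : ℝ}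
    (hε0 : 0 < ε)
    {K : En n → ℝ} {B N : ℝ} {f : En n → ℂ} (hK : CZK n K B) (hf : HF n Ω ε f N)
    {x x' : En n} {η : ℝ} (hη : 0 < η) (h : ∀ y ∈ Ω, η ≤ ‖x - y‖) (hxx : 2 * ‖x - x'‖ ≤ η) :
    ‖TT Ω K f x - TT Ω K f x'‖ ≤
      volume.real Ω * (2 ^ (n + 1) / η ^ (n + 1)) * B * N * ‖x - x'‖ := by
  have h' : ∀ y ∈ Ω, η / 2 ≤ ‖x' - y‖ := by
    intro y hy
    have h1 : ‖x - y‖ ≤ ‖x - x'‖ + ‖x' - y‖ := by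
      have := norm_add_le (x - x') (x' - y)
      rwa [sub_add_sub_cancel] at this
    have := h y hy
    linarith
  have i1 := hf.mul_int hΩo hε0 (hK.intOn x Ω hΩo.measurableSet hΩv hη h)
  have i2 := hf.mul_int hΩo hε0 (hK.intOn x' Ω hΩo.measurableSet hΩv (by positivity) h')
  unfold TT
  rw [← integral_sub i1 i2]
  have hB := hK.nonneg
  have h1 := norm_setIntegral_le_of_norm_le_const (μ := volume) (s := Ω)
    (C := N * (B * 2 ^ (n + 1) * ‖x - x'‖ / η ^ (n + 1)))
    (f := fun y => f y * (K (x - y) : ℂ) - f y * (K (x' - y) : ℂ)) hΩv.lt_top (by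
      intro y hy
      rw [← mul_sub, ← Complex.ofReal_sub, norm_mul, Complex.norm_real, Real.norm_eq_abs]
      refine mul_le_mul (hf.bd y hy) ?_ (abs_nonneg _) hf.nonneg
      have hη' := h y hy
      refine (hK.diff x x' y (sub_ne_zero.1 (norm_pos_ne hη hη')) (hxx.trans hη')).trans ?_
      gcongr)
  refine h1.trans (le_of_eq ?_)
  ring

lemma globalBd {n : ℕ} {Ω : Set (En n)} {ε : ℝ} (hε0 : 0 < ε) (hε1 : ε < 1)
    (hΩo : IsOpen Ω) (hΩb : Bornology.IsBounded Ω) (hΩ : HasC1HolderBoundary n ε Ω) :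
    ∃ C : ℝ, 0 ≤ C ∧ ∀ K B f N, CZK n K B → HF n Ω ε f N →
      (∀ x ∉ closure Ω, ‖TT Ω K f x‖ ≤ C * B * N) ∧
      (∀ x ∉ closure Ω, ∀ x' ∉ closure Ω,
        ‖TT Ω K f x - TT Ω K f x'‖ ≤ C * B * N * ‖x - x'‖ ^ ε) := by
  have hΩv : volume Ω ≠ ⊤ := hΩb.measure_lt_top.ne
  obtain ⟨hn, hch⟩ := hΩ
  have hloc : ∀ a : frontier Ω, ∃ ρ : ℝ, 0 < ρ ∧ ∃ q ∈ ball a.1 ρ, q ∉ closure Ω ∧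
    ∃ η : ℝ, 0 < η ∧ (∀ y ∈ Ω, η ≤ ‖q - y‖) ∧
    ∃ C : ℝ, 0 ≤ C ∧ ∀ K B f N, CZK n K B → HF n Ω ε f N → ∀ x ∈ ball a.1 ρ, ∀ x' ∈ ball a.1 ρ,
      x ∉ closure Ω → x' ∉ closure Ω →
      ‖TT Ω K f x - TT Ω K f x'‖ ≤ C * B * N * ‖x - x'‖ ^ ε := by
    rintro ⟨a, ha⟩
    obtain ⟨r, hr, R, φ, hφ, ⟨c, hc⟩, hmem⟩ := hch a ha
    obtain ⟨L, M, Φ, e, ch⟩ := exists_chart hε0 hΩo hn ha hr R φ hφ c hc hmem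
    obtain ⟨ρ, hρ, ⟨q, hq, hqc⟩, C, hC, hh⟩ := localHolder hn hε0 hε1 hΩo hΩv ch
    obtain ⟨η, hη, hηq⟩ := far_of_notMem hqc
    exact ⟨ρ, hρ, q, hq, hqc, η, hη, hηq, C, hC, hh⟩
  choose ρ hρ q hq hqc η hη hηq Cl hCl hl using hloc
  have hcomp : IsCompact (frontier Ω) :=
    Metric.isCompact_of_isClosed_isBounded isClosed_frontier
      (hΩb.closure.subset frontier_subset_closure)
  obtain ⟨t, ht⟩ := hcomp.elim_finite_subcover (fun a : frontier Ω => ball a.1 (ρ a))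
    (fun a => isOpen_ball) (fun a ha => mem_iUnion.2 ⟨⟨a, ha⟩, mem_ball_self (hρ _)⟩)
  obtain ⟨δ, hδ, hδb⟩ := lebesgue_number_lemma_of_metric hcomp
    (c := fun a : t => ball a.1.1 (ρ a.1)) (fun a => isOpen_ball) (by
      intro z hz
      have := ht hz
      simp only [mem_iUnion] at this ⊢
      obtain ⟨a, hat, hza⟩ := this
      exact ⟨⟨a, hat⟩, hza⟩)
  set V := volume.real Ω with hV
  have hV0 : 0 ≤ V := measureReal_nonneg
  set D : frontier Ω → ℝ := fun a => V / η a ^ n + Cl a * (2 * ρ a) ^ ε with hD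
  have hD0 : ∀ a, 0 ≤ D a := fun a => by
    have := hη a; have := hCl a; have := hρ a
    simp only [hD]; positivity
  set S := V / (δ / 2) ^ n + ∑ a ∈ t, D a with hS
  have hSD : 0 ≤ ∑ a ∈ t, D a := Finset.sum_nonneg (fun a _ => hD0 a)
  have hS0 : 0 ≤ S := by positivity
  have hCsum : 0 ≤ ∑ a ∈ t, Cl a := Finset.sum_nonneg (fun a _ => hCl a)
  set C1 := 2 * S / (δ / 4) ^ ε with hC1
  have hC10 : 0 ≤ C1 := by positivity
  set C2 := V * (2 ^ (n + 1) / (δ / 2) ^ (n + 1)) * (δ / 4) ^ (1 - ε) with hC2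
  have hC20 : 0 ≤ C2 := by positivity
  -- points close to the set are in one of the balls
  have near : ∀ x ∉ closure Ω, (∃ y ∈ Ω, ‖x - y‖ < δ / 2) →
      ∃ a ∈ t, ball x (δ / 2) ⊆ ball a.1 (ρ a) := by
    rintro x hx ⟨y, hy, hxy⟩
    have hseg : segment ℝ x y ⊆ ball x (δ / 2) := (convex_ball x (δ / 2)).segment_subset
      (mem_ball_self (by positivity)) (by rw [mem_ball, dist_comm, dist_eq_norm]; exact hxy)
    obtain ⟨z, hz1, hz2⟩ : ∃ z ∈ segment ℝ x y, z ∈ frontier Ω := by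
      by_contra! hno
      obtain ⟨z, -, hz2, hz3⟩ := (convex_segment x y).isPreconnected Ω (closure Ω)ᶜ hΩo
        isClosed_closure.isOpen_compl (by
          intro z hz
          by_cases h : z ∈ closure Ω
          · left
            by_contra h2
            exact hno z hz (by rw [hΩo.frontier_eq]; exact ⟨h, h2⟩)
          · right; exact h) ⟨y, right_mem_segment ℝ x y, hy⟩ ⟨x, left_mem_segment ℝ x y, hx⟩
      exact hz3 (subset_closure hz2)
    obtain ⟨a, ha⟩ := hδb z hz2
    refine ⟨a.1, a.2, Subset.trans ?_ ha⟩
    apply ball_subset_ball'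
    have := hseg hz1
    rw [mem_ball, dist_comm] at this
    linarith
  refine ⟨S + C1 + C2 + ∑ a ∈ t, Cl a, by positivity, ?_⟩
  intro K B f N hK hf
  have hB := hK.nonneg
  have hN := hf.nonneg
  have bdS : ∀ x ∉ closure Ω, ‖TT Ω K f x‖ ≤ S * B * N := by
    intro x hx
    by_cases hc : ∃ y ∈ Ω, ‖x - y‖ < δ / 2
    · obtain ⟨a, hat, hb⟩ := near x hx hc
      have hxa := hb (mem_ball_self (by positivity))
      have h1 := hl a K B f N hK hf x hxa (q a) (hq a) hx (hqc a)
      have h2 := TT_far hΩv hK hf (hη a) (hηq a)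
      have h3 : ‖x - q a‖ ≤ 2 * ρ a := by
        have h4 := hq a
        rw [mem_ball] at hxa h4
        rw [← dist_eq_norm]
        have := dist_triangle_right x (q a) a.1
        linarith
      have h5 : ‖x - q a‖ ^ ε ≤ (2 * ρ a) ^ ε := Real.rpow_le_rpow (norm_nonneg _) h3 hε0.le
      have h6 : ‖TT Ω K f x‖ ≤ ‖TT Ω K f x - TT Ω K f (q a)‖ + ‖TT Ω K f (q a)‖ := by
        have := norm_add_le (TT Ω K f x - TT Ω K f (q a)) (TT Ω K f (q a))
        rwa [sub_add_cancel] at this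
      have h7 : Cl a * B * N * ‖x - q a‖ ^ ε ≤ Cl a * B * N * (2 * ρ a) ^ ε :=
        mul_le_mul_of_nonneg_left h5 (mul_nonneg (mul_nonneg (hCl a) hB) hN)
      have h8 : D a ≤ S := by
        have := Finset.single_le_sum (fun a _ => hD0 a) hat
        have : 0 ≤ V / (δ / 2) ^ n := by positivity
        linarith
      calc ‖TT Ω K f x‖ ≤ Cl a * B * N * (2 * ρ a) ^ ε + V / η a ^ n * B * N := by linarith
        _ = D a * B * N := by simp only [hD]; ring
        _ ≤ S * B * N := by gcongr
    · push Not at hc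
      refine (TT_far hΩv hK hf (by positivity : 0 < δ / 2) hc).trans ?_
      gcongr
      linarith
  refine ⟨fun x hx => (bdS x hx).trans ?_, ?_⟩
  · gcongr; linarith
  intro x hx x' hx'
  rcases le_or_gt (δ / 4) ‖x - x'‖ with hcase | hcase
  · have h1 : ‖TT Ω K f x - TT Ω K f x'‖ ≤ 2 * S * B * N := by
      have := norm_sub_le (TT Ω K f x) (TT Ω K f x')
      have := bdS x hx
      have := bdS x' hx'
      linarith
    have h2 : (δ / 4) ^ ε ≤ ‖x - x'‖ ^ ε := Real.rpow_le_rpow (by positivity) hcase hε0.le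
    have h3 : 0 < (δ / 4) ^ ε := by positivity
    calc _ ≤ 2 * S * B * N := h1
      _ = C1 * B * N * (δ / 4) ^ ε := by rw [hC1]; field_simp
      _ ≤ C1 * B * N * ‖x - x'‖ ^ ε := by gcongr
      _ ≤ _ := by gcongr; linarith
  · by_cases hc : ∃ y ∈ Ω, ‖x - y‖ < δ / 2
    · obtain ⟨a, hat, hb⟩ := near x hx hc
      have hxa := hb (mem_ball_self (by positivity))
      have hxa' : x' ∈ ball a.1 (ρ a) := hb (by
        rw [mem_ball, dist_comm, dist_eq_norm]; linarith)
      refine (hl a K B f N hK hf x hxa x' hxa' hx hx').trans ?_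
      have := Finset.single_le_sum (fun a _ => hCl a) hat
      gcongr
      linarith
    · push Not at hc
      refine (TT_diff_far hΩo hΩv hε0 hK hf (by positivity : 0 < δ / 2) hc (by linarith)).trans ?_
      have h1 : ‖x - x'‖ ≤ (δ / 4) ^ (1 - ε) * ‖x - x'‖ ^ ε := by
        rcases eq_or_lt_of_le (norm_nonneg (x - x')) with h0 | h0
        · rw [← h0]; positivity
        · calc ‖x - x'‖ = ‖x - x'‖ ^ (1 - ε) * ‖x - x'‖ ^ ε := by
                rw [← Real.rpow_add h0]; simp
            _ ≤ _ := by
                gcongr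
      calc _ ≤ V * (2 ^ (n + 1) / (δ / 2) ^ (n + 1)) * B * N * ((δ / 4) ^ (1 - ε) * ‖x - x'‖ ^ ε) := by
            gcongr
        _ = C2 * B * N * ‖x - x'‖ ^ ε := by rw [hC2]; ring
        _ ≤ _ := by gcongr; linarith

lemma kernel_smooth {n : ℕ} {ω K : En n → ℝ} (hK : ∀ x, x ≠ 0 → K x = ω x / ‖x‖ ^ n)
    (hωs : ContDiffOn ℝ 1 ω {(0 : En n)}ᶜ) : ContDiffOn ℝ 1 K {(0 : En n)}ᶜ := by
  have h1 : ContDiffOn ℝ 1 (fun x : En n => ω x / ‖x‖ ^ n) {(0 : En n)}ᶜ := by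
    refine hωs.div ?_ ?_
    · intro x hx
      exact ((contDiffAt_norm ℝ hx).pow n).contDiffWithinAt
    · intro x hx
      exact pow_ne_zero _ (norm_ne_zero_iff.2 hx)
  exact h1.congr (fun x hx => hK x hx)

lemma mkCZK {n : ℕ} (hn : 0 < n) (ω K : En n → ℝ)
    (hK : ∀ x, x ≠ 0 → K x = ω x / ‖x‖ ^ n)
    (hωh : ∀ t : ℝ, 0 < t → ∀ x, ω (t • x) = ω x)
    (hωe : ∀ x, ω (-x) = ω x)
    (hωs : ContDiffOn ℝ 1 ω {(0 : En n)}ᶜ)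
    (h0 : (∫ ξ in sphere (0 : En n) 1, ω ξ ∂μH[(n : ℝ) - 1]) = 0)
    (hB : czConst n K ≠ ⊤) : CZK n K (czConst n K).toReal := by
  refine ⟨ENNReal.toReal_nonneg, kernel_smooth hK hωs, ?_, ?_, ?_, ?_,
    fun a b ha _ => mean_zero hn ω K hK hωh hωs h0 a b ha⟩
  · intro z hz
    have hz0 : 0 < ‖z‖ := norm_pos_iff.2 hz
    rw [le_div_iff₀ (by positivity), ← ENNReal.ofReal_le_iff_le_toReal hB]
    unfold czConst
    refine le_trans ?_ le_self_add
    exact le_iSup (fun x : {x : En n // x ≠ 0} => ENNReal.ofReal (|K x.1| * ‖x.1‖ ^ n)) ⟨z, hz⟩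
  · intro z hz
    have hz0 : 0 < ‖z‖ := norm_pos_iff.2 hz
    rw [le_div_iff₀ (by positivity), ← ENNReal.ofReal_le_iff_le_toReal hB]
    unfold czConst
    refine le_trans ?_ le_add_self
    exact le_iSup (fun x : {x : En n // x ≠ 0} =>
      ENNReal.ofReal (‖fderiv ℝ K x.1‖ * ‖x.1‖ ^ (n + 1))) ⟨z, hz⟩
  · intro t ht z hz
    rw [hK z hz, hK _ (smul_ne_zero ht.ne' hz), hωh t ht, norm_smul, Real.norm_of_nonneg ht.le,
      mul_pow]
    field_simp
  · intro z
    by_cases hz : z = 0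
    · rw [hz, neg_zero]
    · rw [hK z hz, hK _ (neg_ne_zero.2 hz), hωe, norm_neg]

lemma mkHF {n : ℕ} {Ω : Set (En n)} {ε : ℝ} (hε0 : 0 < ε) (f : En n → ℂ)
    (hf : holderNorm ε Ω f ≠ ⊤) : HF n Ω ε f (holderNorm ε Ω f).toReal := by
  refine ⟨ENNReal.toReal_nonneg, ?_, ?_⟩
  · intro y hy
    rw [← ENNReal.ofReal_le_iff_le_toReal hf]
    unfold holderNorm
    refine le_trans ?_ le_self_add
    rw [ofReal_norm_eq_enorm]
    exact le_iSup (fun x : Ω => (‖f x.1‖₊ : ℝ≥0∞)) ⟨y, hy⟩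
  · intro y hy z hz
    by_cases hyz : y = z
    · rw [hyz, sub_self, norm_zero, sub_self, norm_zero]; positivity
    · have h0 : 0 < ‖y - z‖ := norm_pos_iff.2 (sub_ne_zero.2 hyz)
      rw [← div_le_iff₀ (by positivity), ← ENNReal.ofReal_le_iff_le_toReal hf]
      unfold holderNorm
      refine le_trans ?_ le_add_self
      exact le_iSup (fun p : Ω × Ω => ENNReal.ofReal (‖f p.1.1 - f p.2.1‖ / ‖p.1.1 - p.2.1‖ ^ ε))
        (⟨y, hy⟩, ⟨z, hz⟩)

lemma holderNorm_le {n : ℕ} {Ω : Set (En n)} {ε : ℝ} (g : En n → ℂ) (D : ℝ)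
    (hD : 0 ≤ D) (h1 : ∀ x ∈ Ω, ‖g x‖ ≤ D)
    (h2 : ∀ x ∈ Ω, ∀ x' ∈ Ω, ‖g x - g x'‖ ≤ D * ‖x - x'‖ ^ ε) :
    holderNorm ε Ω g ≤ ENNReal.ofReal (2 * D) := by
  rw [two_mul, ENNReal.ofReal_add hD hD]
  unfold holderNorm
  refine add_le_add (iSup_le ?_) (iSup_le ?_)
  · rintro ⟨x, hx⟩
    have := ENNReal.ofReal_le_ofReal (h1 x hx)
    rwa [ofReal_norm_eq_enorm] at this
  · rintro ⟨⟨x, hx⟩, ⟨x', hx'⟩⟩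
    apply ENNReal.ofReal_le_ofReal
    exact div_le_of_le_mul₀ (by positivity) hD (h2 x hx x' hx')


/-- For a bounded `C^{1+ε}` domain `Ω ⊆ ℝ^n` and an even smooth homogeneous
Calderón–Zygmund operator with kernel `K`, for every `f ∈ Lip(ε,Ω)` and `x` outside the closure
of `Ω` the integral `Tf(x) = ∫_Ω f(y)K(x−y)dy` converges absolutely, and
`‖Tf‖_{ε,ℝ^n∖closure Ω} ≤ C ‖T‖_CZ ‖f‖_{ε,Ω}` with `C = C(n,ε,Ω)`. -/
theorem statement1 (n : ℕ) (ε : ℝ) (hε0 : 0 < ε) (hε1 : ε < 1)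
    (Ω : Set (En n)) (hΩo : IsOpen Ω) (hΩc : IsConnected Ω)
    (hΩb : Bornology.IsBounded Ω) (hΩ : HasC1HolderBoundary n ε Ω) :
    ∃ C : ℝ≥0, 0 < C ∧
      ∀ ω K : En n → ℝ,
        (∀ x, x ≠ 0 → K x = ω x / ‖x‖ ^ n) →
        (∀ t : ℝ, 0 < t → ∀ x, ω (t • x) = ω x) →
        (∀ x, ω (-x) = ω x) →
        ContDiffOn ℝ 1 ω {(0 : En n)}ᶜ →
        (∫ ξ in sphere (0 : En n) 1, ω ξ ∂μH[(n : ℝ) - 1]) = 0 →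
        ∀ f : En n → ℂ, holderNorm ε Ω f ≠ ⊤ →
          (∀ x ∉ closure Ω, IntegrableOn (fun y => f y * (K (x - y) : ℂ)) Ω) ∧
          holderNorm ε ((closure Ω)ᶜ)
              (fun x => ∫ y in Ω, f y * (K (x - y) : ℂ)) ≤
            ↑C * czConst n K * holderNorm ε Ω f := by
  obtain ⟨C, hC, hglob⟩ := globalBd hε0 hε1 hΩo hΩb hΩ
  obtain ⟨hn, -⟩ := hΩ
  refine ⟨(2 * C + 1).toNNReal, by rw [Real.toNNReal_pos]; positivity, ?_⟩
  intro ω K hK hωh hωe hωs h0 f hf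
  have hF := mkHF hε0 f hf
  have hKs := kernel_smooth hK hωs
  refine ⟨?_, ?_⟩
  · intro x hx
    apply hF.mul_int hΩo hε0
    have hcl : IsCompact (closure Ω) := hΩb.isCompact_closure
    have : IntegrableOn (fun y => K (x - y)) (closure Ω) := by
      apply ContinuousOn.integrableOn_compact hcl
      apply hKs.continuousOn.comp (by fun_prop)
      intro y hy h
      rw [mem_singleton_iff, sub_eq_zero] at h
      exact hx (h ▸ hy)
    exact this.mono_set subset_closure
  · by_cases hB : czConst n K = ⊤
    · by_cases hN : holderNorm ε Ω f = 0
      · have hz : ∀ y ∈ Ω, f y = 0 := by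
          intro y hy
          have := hF.bd y hy
          rw [hN, ENNReal.toReal_zero] at this
          exact norm_le_zero_iff.1 this
        have hT : ∀ x, ∫ y in Ω, f y * (K (x - y) : ℂ) = 0 := by
          intro x
          rw [setIntegral_congr_fun (g := fun _ => (0 : ℂ)) hΩo.measurableSet
            (fun y hy => by simp [hz y hy])]
          simp
        simp only [hT]
        refine (holderNorm_le (fun _ => (0 : ℂ)) 0 le_rfl (by simp) (by simp)).trans ?_
        simp
      · rw [hB, ENNReal.mul_top, ENNReal.top_mul hN]
        · exact le_top
        · rw [ENNReal.coe_ne_zero]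
          exact (Real.toNNReal_pos.2 (by positivity)).ne'
    · have hcz := mkCZK hn ω K hK hωh hωe hωs h0 hB
      obtain ⟨g1, g2⟩ := hglob K _ f _ hcz hF
      have hB0 := hcz.nonneg
      have hN0 := hF.nonneg
      refine (holderNorm_le (TT Ω K f) _ (by positivity) g1 g2).trans ?_
      have e1 : (2 * (C * (czConst n K).toReal * (holderNorm ε Ω f).toReal)) ≤
        (2 * C + 1) * (czConst n K).toReal * (holderNorm ε Ω f).toReal := by
        have : 0 ≤ (czConst n K).toReal * (holderNorm ε Ω f).toReal := by positivity
        nlinarith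
      refine (ENNReal.ofReal_le_ofReal e1).trans (le_of_eq ?_)
      rw [ENNReal.ofReal_mul (by positivity), ENNReal.ofReal_mul (by positivity),
        ENNReal.ofReal_toReal hB, ENNReal.ofReal_toReal hf]
      rfl

end
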